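/- arXiv:1409.2034 — 2 statements merged into one kernel-verified Lean document; each statement's English description precedes it below -/
import Mathlib

section
/- As n → ∞ along integers n such that n+1 IS divisible by 4, the probability that a uniformly random Littlewood polynomial of degree n has a double root is asymptotic to 8√3/(π n²); that is, n² · N_n / 2^{n+1} → 8√3/π along this subsequence. -/
open Filter

/-- The polynomial `∑_{j=0}^n a_j z^j` with integer coefficients, viewed over `ℂ`. -/
noncomputable def polyOf (n : ℕ) (a : Fin (n + 1) → ℤ) : Polynomial ℂ :=
  ∑ j : Fin (n + 1), Polynomial.C (a j : ℂ) * Polynomial.X ^ (j : ℕ)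

/-- The polynomial with coefficients `a` has a double root in `ℂ`. -/
def hasDoubleRoot (n : ℕ) (a : Fin (n + 1) → ℤ) : Prop :=
  ∃ z : ℂ, (polyOf n a).eval z = 0 ∧ (Polynomial.derivative (polyOf n a)).eval z = 0

/-- `N_n`: the number of sign vectors `(a_0, …, a_n) ∈ {-1,1}^{n+1}` such that the
Littlewood polynomial `∑ a_j z^j` has a double root in `ℂ`. -/
noncomputable def littlewoodDoubleRootCount (n : ℕ) : ℕ :=
  Nat.card {a : Fin (n + 1) → ℤ // (∀ j, a j = 1 ∨ a j = -1) ∧ hasDoubleRoot n a}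

open Filter

lemma abs_cos_le_exp (t : ℝ) : |Real.cos t| ≤ Real.exp (-(Real.sin t ^ 2) / 2) := by
  have h1 : Real.cos t ^ 2 ≤ Real.exp (-(Real.sin t ^ 2) / 2) ^ 2 := by
    rw [← Real.exp_nat_mul]
    have := Real.add_one_le_exp (((2:ℕ):ℝ) * (-(Real.sin t ^ 2) / 2))
    have h2 := Real.sin_sq_add_cos_sq t
    push_cast at *
    linarith
  exact abs_le_of_sq_le_sq h1 (Real.exp_pos _).le |> fun h => h

noncomputable def SS (N : ℕ) (x y : ℝ) : ℝ := ∑ j ∈ Finset.range N, Real.sin (x + j * y) ^ 2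

noncomputable def PC (N : ℕ) (x y : ℝ) : ℝ := ∏ j ∈ Finset.range N, Real.cos (x + j * y)

lemma abs_PC_le (N : ℕ) (x y : ℝ) : |PC N x y| ≤ Real.exp (-(SS N x y) / 2) := by
  unfold PC SS
  rw [Finset.abs_prod]
  calc _ ≤ ∏ j ∈ Finset.range N, Real.exp (-(Real.sin (x + j * y) ^ 2) / 2) :=
        Finset.prod_le_prod (fun _ _ => abs_nonneg _) (fun _ _ => abs_cos_le_exp _)
    _ = _ := by
        rw [← Real.exp_sum]; congr 1
        rw [← Finset.sum_neg_distrib, Finset.sum_div]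

lemma sin_sub_sq_le (a b : ℝ) : Real.sin (a - b) ^ 2 ≤ 2 * (Real.sin a ^ 2 + Real.sin b ^ 2) := by
  rw [Real.sin_sub]
  have h1 := Real.sin_sq_add_cos_sq a
  have h2 := Real.sin_sq_add_cos_sq b
  nlinarith [sq_nonneg (Real.sin a * Real.cos b + Real.cos a * Real.sin b),
    mul_nonneg (sq_nonneg (Real.sin a)) (sq_nonneg (Real.sin b))]

lemma sin_sq_ge (t : ℝ) (ht : |t| ≤ Real.pi / 2) : 4 / Real.pi ^ 2 * t ^ 2 ≤ Real.sin t ^ 2 := by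
  have h := Real.mul_abs_le_abs_sin ht
  have h2 : (2 / Real.pi * |t|) ^ 2 ≤ |Real.sin t| ^ 2 :=
    pow_le_pow_left₀ (by positivity) h 2
  rw [sq_abs, mul_pow, sq_abs, div_pow] at h2
  norm_num at h2 ⊢
  exact h2

lemma four_div_pi_sq : (0.4 : ℝ) ≤ 4 / Real.pi ^ 2 := by
  rw [le_div_iff₀ (by positivity)]
  have := Real.pi_lt_d2
  have := Real.pi_pos
  nlinarith

lemma SS_y (N : ℕ) (hN : 2 ≤ N) (x y : ℝ) (hy : |y| ≤ Real.pi / N) :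
    (1 / 270 : ℝ) * (N ^ 3 * y ^ 2) ≤ SS N x y := by
  have hNpos : (0:ℝ) < N := by positivity
  obtain ⟨h, rfl | rfl⟩ := Nat.even_or_odd' N
  all_goals
    have hle : ∑ j ∈ Finset.range h, Real.sin (h * y) ^ 2 / 2 ≤ SS (h + h) x y := by
      unfold SS
      rw [Finset.sum_range_add, ← Finset.sum_add_distrib]
      apply Finset.sum_le_sum
      intro j _
      have := sin_sub_sq_le (x + ((h + j : ℕ) : ℝ) * y) (x + j * y)
      have e : x + ((h + j : ℕ) : ℝ) * y - (x + j * y) = h * y := by push_cast; ring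
      rw [e] at this
      linarith
    rw [Finset.sum_const, Finset.card_range, nsmul_eq_mul] at hle
    have hh : |(h:ℝ) * y| ≤ Real.pi / 2 := by
      rw [abs_mul, Nat.abs_cast]
      rw [le_div_iff₀ hNpos] at hy
      push_cast at hy
      nlinarith [abs_nonneg y]
    have h1 := sin_sq_ge _ hh
    have h3 : 0.4 * (h * y) ^ 2 ≤ Real.sin (h * y) ^ 2 :=
      (mul_le_mul_of_nonneg_right four_div_pi_sq (sq_nonneg _)).trans h1
    have h4 : (h:ℝ) * (0.4 * (h * y) ^ 2) ≤ h * Real.sin (h * y) ^ 2 :=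
      mul_le_mul_of_nonneg_left h3 (by positivity)
  · have e : 2 * h = h + h := by ring
    rw [e]
    push_cast
    have : 0 ≤ (h:ℝ)^3 * y^2 := by positivity
    nlinarith
  · have hm : SS (h + h) x y ≤ SS (2 * h + 1) x y := by
      unfold SS
      apply Finset.sum_le_sum_of_subset_of_nonneg
      · intro j; simp; omega
      · intros; positivity
    have h1 : (1:ℝ) ≤ h := by exact_mod_cast (by omega : 1 ≤ h)
    have h5 : ((2 * h + 1 : ℕ) : ℝ) ^ 3 ≤ (3 * h : ℝ) ^ 3 := by
      apply pow_le_pow_left₀ (by positivity)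
      push_cast; linarith
    have h6 := mul_le_mul_of_nonneg_right h5 (sq_nonneg y)
    nlinarith

lemma SS_x (N : ℕ) (x y : ℝ) :
    (N : ℝ) * Real.sin x ^ 2 ≤ 2 * SS N x y + 2 * (N ^ 3 * y ^ 2) := by
  have : ∀ j ∈ Finset.range N, Real.sin x ^ 2 ≤ 2 * Real.sin (x + j * y) ^ 2 + 2 * (N ^ 2 * y ^ 2) := by
    intro j hj
    have h1 := sin_sub_sq_le (x + j * y) (j * y)
    rw [add_sub_cancel_right] at h1
    have h2 : Real.sin (j * y) ^ 2 ≤ (j * y) ^ 2 := by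
      have := Real.abs_sin_le_abs (x := j * y)
      exact sq_le_sq.mpr this
    have h3 : ((j:ℝ) * y) ^ 2 ≤ N ^ 2 * y ^ 2 := by
      rw [mul_pow]
      have : (j:ℝ) ≤ N := by exact_mod_cast (Finset.mem_range.mp hj).le
      gcongr
    linarith
  have := Finset.sum_le_sum this
  rw [Finset.sum_const, Finset.card_range, nsmul_eq_mul, Finset.sum_add_distrib, ← Finset.mul_sum,
    Finset.sum_const, Finset.card_range, nsmul_eq_mul] at this
  unfold SS
  linarith

lemma SS_A (N : ℕ) (hN : 2 ≤ N) (x y : ℝ) (hx : |x| ≤ Real.pi / 2) (hy : |y| ≤ Real.pi / N) :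
    (1 / 10000 : ℝ) * (N * x ^ 2 + N ^ 3 * y ^ 2) ≤ SS N x y / 2 := by
  have h1 := SS_y N hN x y hy
  have h2 := SS_x N x y
  have h3 : 0.4 * x ^ 2 ≤ Real.sin x ^ 2 :=
      (mul_le_mul_of_nonneg_right four_div_pi_sq (sq_nonneg _)).trans (sin_sq_ge _ hx)
  have h4 : (N:ℝ) * (0.4 * x ^ 2) ≤ N * Real.sin x ^ 2 :=
      mul_le_mul_of_nonneg_left h3 (by positivity)
  have : 0 ≤ (N:ℝ)^3 * y^2 := by positivity
  have : 0 ≤ (N:ℝ) * x^2 := by positivity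
  linarith

lemma SS_B (N : ℕ) (hN : 2 ≤ N) (x y : ℝ) (hy : |y| ≤ Real.pi / 2) (hy' : Real.pi / N ≤ |y|) :
    (N : ℝ) / 4 ≤ SS N x y := by
  have hNpos : (0:ℝ) < N := by positivity
  set w : ℂ := Complex.exp (2 * y * Complex.I) with hw
  have hw1 : 4 / (N:ℝ) ≤ ‖w - 1‖ := by
    have : w - 1 = Complex.exp (y * Complex.I) * (2 * Complex.I * Complex.sin y) := by
      rw [Complex.sin, hw]
      have e : (2 * y * Complex.I : ℂ) = y * Complex.I + y * Complex.I := by ring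
      rw [e, Complex.exp_add]
      have e2 : Complex.exp (-y * Complex.I) = (Complex.exp (y * Complex.I))⁻¹ := by
        rw [← Complex.exp_neg]; ring_nf
      rw [e2]
      have := Complex.exp_ne_zero (y * Complex.I)
      field_simp
      linear_combination (Complex.exp (y * Complex.I) ^ 2 - 1) * Complex.I_sq
    rw [this, norm_mul, Complex.norm_exp_ofReal_mul_I, ← Complex.ofReal_sin]
    simp only [norm_mul, Complex.norm_I, Complex.norm_real, Complex.norm_ofNat, one_mul, mul_one]
    have h := Real.mul_abs_le_abs_sin hy
    rw [Real.norm_eq_abs]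
    have : 2 / Real.pi * (Real.pi / N) ≤ 2 / Real.pi * |y| := by gcongr
    have e : 2 / Real.pi * (Real.pi / N) = 2 / N := by field_simp
    have e3 : 4 / (N:ℝ) = 2 * (2 / N) := by ring
    rw [e3]
    linarith
  have hgeo : ‖∑ j ∈ Finset.range N, w ^ j‖ ≤ N / 2 := by
    have h := geom_sum_mul w N
    have hn : ‖w‖ = 1 := by
      rw [hw]; have := Complex.norm_exp_ofReal_mul_I (2 * y); push_cast at this; exact this
    have h2 : ‖∑ j ∈ Finset.range N, w ^ j‖ * ‖w - 1‖ ≤ 2 := by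
      rw [← norm_mul, h]
      calc _ ≤ ‖w ^ N‖ + ‖(1:ℂ)‖ := norm_sub_le _ _
        _ = 2 := by rw [norm_pow, hn]; norm_num
    have h3 := mul_le_mul_of_nonneg_left hw1 (norm_nonneg (∑ j ∈ Finset.range N, w ^ j))
    have h4 := h3.trans h2
    rw [mul_div_assoc', div_le_iff₀ hNpos] at h4
    linarith
  have hre : ∑ j ∈ Finset.range N, Real.cos (2 * (x + j * y)) =
      (Complex.exp (2 * x * Complex.I) * ∑ j ∈ Finset.range N, w ^ j).re := by
    rw [Finset.mul_sum, Complex.re_sum]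
    apply Finset.sum_congr rfl
    intro j _
    rw [hw, ← Complex.exp_nat_mul, ← Complex.exp_add]
    have : (2 * x * Complex.I + j * (2 * y * Complex.I) : ℂ) = ((2 * (x + j * y) : ℝ) : ℂ) * Complex.I := by
      push_cast; ring
    rw [this, Complex.exp_ofReal_mul_I_re]
  have hb : ∑ j ∈ Finset.range N, Real.cos (2 * (x + j * y)) ≤ N / 2 := by
    rw [hre]
    refine (Complex.re_le_norm _).trans ?_
    rw [norm_mul]
    have := Complex.norm_exp_ofReal_mul_I (2 * x)
    push_cast at this
    rw [this, one_mul]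
    exact hgeo
  have : SS N x y = N / 2 - (∑ j ∈ Finset.range N, Real.cos (2 * (x + j * y))) / 2 := by
    unfold SS
    simp_rw [Real.sin_sq_eq_half_sub]
    rw [Finset.sum_sub_distrib, Finset.sum_const, Finset.card_range, nsmul_eq_mul, Finset.sum_div]
    ring
  linarith

open Filter

open MeasureTheory in
lemma integral_scale (a b : ℝ) (ha : 0 < a) (hb : 0 < b) (f : ℝ × ℝ → ℝ) :
    ∫ p : ℝ × ℝ, f (a * p.1, b * p.2) = a⁻¹ * b⁻¹ * ∫ p, f p := by
  have hm : Measure.map (Prod.map (fun x => a * x) (fun x => b * x)) (volume : Measure (ℝ × ℝ)) =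
      (ENNReal.ofReal |a⁻¹| * ENNReal.ofReal |b⁻¹|) • (volume : Measure (ℝ × ℝ)) := by
    rw [Measure.volume_eq_prod, ← Measure.map_prod_map _ _ (by fun_prop) (by fun_prop),
      Real.map_volume_mul_left ha.ne', Real.map_volume_mul_left hb.ne',
      Measure.prod_smul_left, Measure.prod_smul_right, smul_smul]
  have he : MeasurableEmbedding (Prod.map (fun x : ℝ => a * x) (fun x : ℝ => b * x)) :=
    ((Homeomorph.mulLeft₀ a ha.ne').prodCongr (Homeomorph.mulLeft₀ b hb.ne')).measurableEmbedding
  have := he.integral_map (μ := volume) f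
  rw [hm, integral_smul_measure] at this
  rw [show (∫ p : ℝ × ℝ, f (a * p.1, b * p.2)) =
    ∫ (x : ℝ × ℝ), f (Prod.map (fun x => a * x) (fun x => b * x) x) from rfl, ← this]
  rw [ENNReal.toReal_mul, ENNReal.toReal_ofReal (abs_nonneg _), ENNReal.toReal_ofReal (abs_nonneg _),
    abs_of_pos (inv_pos.mpr ha), abs_of_pos (inv_pos.mpr hb), smul_eq_mul]

lemma abs_prod_sub_prod_le (N : ℕ) (f g : ℕ → ℝ) (hf : ∀ j, |f j| ≤ 1) (hg : ∀ j, |g j| ≤ 1) :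
    |∏ j ∈ Finset.range N, f j - ∏ j ∈ Finset.range N, g j| ≤ ∑ j ∈ Finset.range N, |f j - g j| := by
  induction N with
  | zero => simp
  | succ n ih =>
    rw [Finset.prod_range_succ, Finset.prod_range_succ, Finset.sum_range_succ]
    have e : (∏ j ∈ Finset.range n, f j) * f n - (∏ j ∈ Finset.range n, g j) * g n =
      (∏ j ∈ Finset.range n, f j - ∏ j ∈ Finset.range n, g j) * f n +
        (∏ j ∈ Finset.range n, g j) * (f n - g n) := by ring
    rw [e]
    refine (abs_add_le _ _).trans ?_
    rw [abs_mul, abs_mul]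
    have h1 : |∏ j ∈ Finset.range n, g j| ≤ 1 := by
      rw [Finset.abs_prod]
      exact Finset.prod_le_one (fun _ _ => abs_nonneg _) (fun _ _ => hg _)
    have h2 := mul_le_mul ih (hf n) (abs_nonneg _) ((abs_nonneg _).trans ih)
    have h3 := mul_le_mul_of_nonneg_right h1 (abs_nonneg (f n - g n))
    linarith

lemma cos_sub_exp (t : ℝ) (ht : |t| ≤ 1) : |Real.cos t - Real.exp (-t ^ 2 / 2)| ≤ t ^ 4 := by
  have h1 := Real.cos_bound ht
  have ht2 : t ^ 2 ≤ 1 := by rw [← sq_abs]; exact pow_le_one₀ (abs_nonneg _) ht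
  have h2 := Real.abs_exp_sub_one_sub_id_le (x := -t ^ 2 / 2) (by
    rw [abs_le]; constructor <;> nlinarith [sq_nonneg t])
  have e : |t| ^ 4 = t ^ 4 := by
    rw [show (4:ℕ) = 2 * 2 from rfl, pow_mul, sq_abs, ← pow_mul]
  rw [e] at h1
  rw [abs_le] at *
  constructor <;> nlinarith [sq_nonneg (t ^ 2)]

lemma sum_t (N : ℕ) (x y : ℝ) : ∑ j ∈ Finset.range N, (x + j * y) ^ 2 =
    N * x ^ 2 + N * (N - 1) * x * y + N * (N - 1) * (2 * N - 1) / 6 * y ^ 2 := by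
  induction N with
  | zero => simp
  | succ n ih => rw [Finset.sum_range_succ, ih]; push_cast; ring

lemma PC_lim (u v : ℝ) : Tendsto (fun N : ℕ => PC N ((√N)⁻¹ * u) ((N * √N : ℝ)⁻¹ * v)) atTop
    (nhds (Real.exp (-(u ^ 2 + u * v + v ^ 2 / 3) / 2))) := by
  set K := |u| + |v| with hK
  have hinv : Tendsto (fun N : ℕ => ((N:ℝ))⁻¹) atTop (nhds 0) := tendsto_inv_atTop_nhds_zero_nat
  have hmain : Tendsto (fun N : ℕ => ∏ j ∈ Finset.range N,
      Real.exp (-((√N)⁻¹ * u + j * ((N * √N : ℝ)⁻¹ * v)) ^ 2 / 2)) atTop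
      (nhds (Real.exp (-(u ^ 2 + u * v + v ^ 2 / 3) / 2))) := by
    have : Tendsto (fun N : ℕ => Real.exp (-(u ^ 2 + (1 - (N:ℝ)⁻¹) * (u * v) +
        (1 - (N:ℝ)⁻¹) * (2 - (N:ℝ)⁻¹) / 6 * v ^ 2) / 2)) atTop
        (nhds (Real.exp (-(u ^ 2 + (1 - 0) * (u * v) + (1 - 0) * (2 - 0) / 6 * v ^ 2) / 2))) := by
      apply (Real.continuous_exp.tendsto _).comp
      have h1 := hinv.const_sub 1
      have h2 := hinv.const_sub 2
      exact (((h1.mul_const _).const_add _).add (((h1.mul h2).div_const _).mul_const _)).neg.div_const _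
    convert this.congr' ?_ using 2
    · ring_nf
    filter_upwards [eventually_gt_atTop 0] with N hN
    have hNpos : (0:ℝ) < N := by exact_mod_cast hN
    rw [← Real.exp_sum, ← Finset.sum_div, Finset.sum_neg_distrib, sum_t]
    congr 1
    have hs : √(N:ℝ) ^ 2 = N := Real.sq_sqrt hNpos.le
    have hs0 : √(N:ℝ) ≠ 0 := (Real.sqrt_pos.mpr hNpos).ne'
    congr 2
    field_simp
    rw [hs]
    ring
  have hdiff : Tendsto (fun N : ℕ => PC N ((√N)⁻¹ * u) ((N * √N : ℝ)⁻¹ * v) - ∏ j ∈ Finset.range N,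
      Real.exp (-((√N)⁻¹ * u + j * ((N * √N : ℝ)⁻¹ * v)) ^ 2 / 2)) atTop (nhds 0) := by
    have hb : Tendsto (fun N : ℕ => K ^ 4 * (N:ℝ)⁻¹) atTop (nhds 0) := by
      simpa using hinv.const_mul (K ^ 4)
    apply squeeze_zero_norm' _ hb
    obtain ⟨M, hM⟩ := exists_nat_gt (K ^ 2)
    filter_upwards [eventually_gt_atTop 0, eventually_ge_atTop M] with N hN hNM
    have hNpos : (0:ℝ) < N := by exact_mod_cast hN
    have hs : √(N:ℝ) ^ 2 = N := Real.sq_sqrt hNpos.le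
    have hs0 : 0 < √(N:ℝ) := (Real.sqrt_pos.mpr hNpos)
    have hKN : K ≤ √N := by
      apply Real.le_sqrt_of_sq_le
      have : (M:ℝ) ≤ N := by exact_mod_cast hNM
      linarith
    have hK0 : 0 ≤ K := by positivity
    rw [Real.norm_eq_abs]
    unfold PC
    refine (abs_prod_sub_prod_le N _ _ (fun j => Real.abs_cos_le_one _) (fun j => ?_)).trans ?_
    · rw [abs_of_pos (Real.exp_pos _), Real.exp_le_one_iff]
      have := sq_nonneg ((√N)⁻¹ * u + j * ((N * √N : ℝ)⁻¹ * v))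
      linarith
    have hterm : ∀ j ∈ Finset.range N, |Real.cos ((√N)⁻¹ * u + j * ((N * √N : ℝ)⁻¹ * v)) -
        Real.exp (-((√N)⁻¹ * u + j * ((N * √N : ℝ)⁻¹ * v)) ^ 2 / 2)| ≤ K ^ 4 / N ^ 2 := by
      intro j hj
      have hjN : (j:ℝ) ≤ N := by exact_mod_cast (Finset.mem_range.mp hj).le
      set t := (√N)⁻¹ * u + j * ((N * √N : ℝ)⁻¹ * v) with ht
      have htb : |t| ≤ K / √N := by
        have e : t = (u + j / N * v) / √N := by rw [ht]; field_simp
        rw [e, abs_div, abs_of_pos hs0]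
        gcongr
        refine (abs_add_le _ _).trans ?_
        rw [abs_mul, abs_of_nonneg (by positivity : 0 ≤ (j:ℝ) / N)]
        have : (j:ℝ) / N ≤ 1 := by rw [div_le_one hNpos]; exact hjN
        have := mul_le_mul_of_nonneg_right this (abs_nonneg v)
        linarith
      have h1 : |t| ≤ 1 := htb.trans (by rw [div_le_one hs0]; exact hKN)
      refine (cos_sub_exp t h1).trans ?_
      have e : t ^ 4 = |t| ^ 4 := by
        rw [show (4:ℕ) = 2 * 2 from rfl, pow_mul, pow_mul, sq_abs]
      rw [e]
      refine (pow_le_pow_left₀ (abs_nonneg _) htb 4).trans ?_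
      rw [div_pow, show √(N:ℝ) ^ 4 = (√(N:ℝ) ^ 2) ^ 2 by ring, hs]
    refine (Finset.sum_le_sum hterm).trans ?_
    rw [Finset.sum_const, Finset.card_range, nsmul_eq_mul]
    apply le_of_eq
    field_simp
  simpa using hdiff.add hmain

open MeasureTheory in
lemma gauss_integrable (c d : ℝ) (hc : 0 < c) (hd : 0 < d) :
    Integrable (fun p : ℝ × ℝ => Real.exp (-c * p.1 ^ 2) * Real.exp (-d * p.2 ^ 2)) :=
  (integrable_exp_neg_mul_sq hc).mul_prod (integrable_exp_neg_mul_sq hd)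

open MeasureTheory in
lemma gauss_lim_integral : ∫ p : ℝ × ℝ, Real.exp (-(p.1 ^ 2 + p.1 * p.2 + p.2 ^ 2 / 3) / 2) =
    4 * Real.pi * √3 := by
  have hint : Integrable (fun p : ℝ × ℝ => Real.exp (-(p.1 ^ 2 + p.1 * p.2 + p.2 ^ 2 / 3) / 2)) := by
    refine (gauss_integrable (1/40) (1/40) (by norm_num) (by norm_num)).mono'
      (by fun_prop) (Eventually.of_forall fun p => ?_)
    rw [Real.norm_eq_abs, abs_of_pos (Real.exp_pos _), ← Real.exp_add]
    apply Real.exp_le_exp.mpr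
    nlinarith [sq_nonneg (p.1 + 0.53 * p.2)]
  rw [Measure.volume_eq_prod] at hint ⊢
  rw [integral_prod_symm _ hint]
  have h1 : ∀ y : ℝ, ∫ x : ℝ, Real.exp (-(x ^ 2 + x * y + y ^ 2 / 3) / 2) =
      √(Real.pi / (1/2)) * Real.exp (-(1/24) * y ^ 2) := by
    intro y
    have e : ∀ x : ℝ, Real.exp (-(x ^ 2 + x * y + y ^ 2 / 3) / 2) =
      (fun x => Real.exp (-(1/2) * x ^ 2)) (x + y / 2) * Real.exp (-(1/24) * y ^ 2) := by
      intro x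
      simp only
      rw [← Real.exp_add]; ring_nf
    simp_rw [e]
    rw [integral_mul_const, integral_add_right_eq_self (fun x => Real.exp (-(1/2) * x ^ 2)),
      integral_gaussian]
  simp_rw [h1]
  rw [integral_const_mul, integral_gaussian, ← Real.sqrt_mul (by positivity)]
  rw [show Real.pi / (1/2) * (Real.pi / (1/24)) = (4 * Real.pi) ^ 2 * 3 by ring,
    Real.sqrt_mul (by positivity), Real.sqrt_sq (by positivity)]

def Bx : Set (ℝ × ℝ) := Set.Icc (-(Real.pi / 2)) (Real.pi / 2) ×ˢ Set.Icc (-(Real.pi / 2)) (Real.pi / 2)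

lemma mem_Bx (p : ℝ × ℝ) : p ∈ Bx ↔ |p.1| ≤ Real.pi / 2 ∧ |p.2| ≤ Real.pi / 2 := by
  simp only [Bx, Set.mem_prod, Set.mem_Icc, abs_le]

lemma Bx_compact : IsCompact Bx := isCompact_Icc.prod isCompact_Icc

lemma PC_cont (N : ℕ) : Continuous (fun p : ℝ × ℝ => PC N p.1 p.2) := by
  unfold PC; fun_prop

open MeasureTheory in
lemma Bx_vol : (volume : Measure (ℝ × ℝ)).real Bx = Real.pi ^ 2 := by
  unfold Bx
  rw [Measure.volume_eq_prod, measureReal_prod_prod, Real.volume_real_Icc_of_le (by linarith [Real.pi_pos])]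
  ring

lemma PC_A (N : ℕ) (hN : 2 ≤ N) (p : ℝ × ℝ) (hx : |p.1| ≤ Real.pi / 2) (hy : |p.2| ≤ Real.pi / N) :
    |PC N p.1 p.2| ≤ Real.exp (-(1/10000 * N) * p.1 ^ 2) * Real.exp (-(1/10000 * N ^ 3) * p.2 ^ 2) := by
  refine (abs_PC_le N _ _).trans ?_
  rw [← Real.exp_add]
  apply Real.exp_le_exp.mpr
  have := SS_A N hN p.1 p.2 hx hy
  linarith

lemma PC_B (N : ℕ) (hN : 2 ≤ N) (p : ℝ × ℝ) (hx : |p.2| ≤ Real.pi / 2) (hy : Real.pi / N ≤ |p.2|) :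
    |PC N p.1 p.2| ≤ Real.exp (-(N:ℝ)/8) := by
  refine (abs_PC_le N _ _).trans ?_
  apply Real.exp_le_exp.mpr
  have := SS_B N hN p.1 p.2 hx hy
  linarith

open MeasureTheory in
lemma PC_bound (N : ℕ) (hN : 2 ≤ N) :
    ∫ p in Bx, |PC N p.1 p.2| ≤ 10000 * Real.pi / N ^ 2 + Real.pi ^ 2 * Real.exp (-(N:ℝ)/8) := by
  have hNpos : (0:ℝ) < N := by positivity
  have hg := gauss_integrable (1/10000 * N) (1/10000 * N ^ 3) (by positivity) (by positivity)
  have hc : IntegrableOn (fun _ : ℝ × ℝ => Real.exp (-(N:ℝ)/8)) Bx :=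
    continuous_const.continuousOn.integrableOn_compact Bx_compact
  calc ∫ p in Bx, |PC N p.1 p.2| ≤ ∫ p in Bx, (Real.exp (-(1/10000 * N) * p.1 ^ 2) *
        Real.exp (-(1/10000 * N ^ 3) * p.2 ^ 2) + Real.exp (-(N:ℝ)/8)) := by
        apply setIntegral_mono_on
        · exact (PC_cont N).abs.continuousOn.integrableOn_compact Bx_compact
        · exact hg.integrableOn.add hc
        · exact Bx_compact.measurableSet
        · intro p hp
          rw [mem_Bx] at hp
          rcases le_total |p.2| (Real.pi / N) with h | h
          · exact (PC_A N hN p hp.1 h).trans (le_add_of_nonneg_right (Real.exp_pos _).le)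
          · exact (PC_B N hN p hp.2 h).trans (le_add_of_nonneg_left (by positivity))
    _ = (∫ p in Bx, (Real.exp (-(1/10000 * N) * p.1 ^ 2) *
        Real.exp (-(1/10000 * N ^ 3) * p.2 ^ 2))) + Real.pi ^ 2 * Real.exp (-(N:ℝ)/8) := by
        rw [integral_add hg.integrableOn hc, setIntegral_const, Bx_vol, smul_eq_mul]
    _ ≤ _ := by
        gcongr
        refine (setIntegral_le_integral hg (Eventually.of_forall fun p => by positivity)).trans ?_
        have := integral_prod_mul (μ := (volume : Measure ℝ)) (ν := (volume : Measure ℝ))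
          (fun x : ℝ => Real.exp (-(1/10000 * N) * x ^ 2))
          (fun y : ℝ => Real.exp (-(1/10000 * N ^ 3) * y ^ 2))
        rw [Measure.volume_eq_prod, this, integral_gaussian, integral_gaussian,
          ← Real.sqrt_mul (by positivity)]
        rw [show Real.pi / (1/10000 * N) * (Real.pi / (1/10000 * N ^ 3)) = (10000 * Real.pi / N ^ 2) ^ 2 by
          field_simp, Real.sqrt_sq (by positivity)]

open MeasureTheory in
lemma PC_int_lim : Tendsto (fun N : ℕ => (N:ℝ) ^ 2 * ∫ p in Bx, PC N p.1 p.2) atTop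
    (nhds (4 * Real.pi * √3)) := by
  let A : ℕ → Set (ℝ × ℝ) := fun N => {p | |p.2| ≤ Real.pi / N}
  have hA : ∀ N, MeasurableSet (A N) := fun N => by
    apply measurableSet_le <;> fun_prop
  have hBm := Bx_compact.measurableSet
  have hPI : ∀ N, IntegrableOn (fun p : ℝ × ℝ => PC N p.1 p.2) Bx := fun N =>
    (PC_cont N).continuousOn.integrableOn_compact Bx_compact
  have h1 : Tendsto (fun N : ℕ => (N:ℝ) ^ 2 * ∫ p in Bx ∩ A N, PC N p.1 p.2) atTop
      (nhds (4 * Real.pi * √3)) := by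
    rw [← gauss_lim_integral]
    let F : ℕ → ℝ × ℝ → ℝ := fun N p =>
      (Bx ∩ A N).indicator (fun p => PC N p.1 p.2) ((√N)⁻¹ * p.1, (N * √N : ℝ)⁻¹ * p.2)
    have hF : ∀ᶠ N : ℕ in atTop, ∫ p, F N p = (N:ℝ) ^ 2 * ∫ p in Bx ∩ A N, PC N p.1 p.2 := by
      filter_upwards [eventually_gt_atTop 0] with N hN
      have hNpos : (0:ℝ) < N := by exact_mod_cast hN
      have hs0 : 0 < √(N:ℝ) := (Real.sqrt_pos.mpr hNpos)
      have hs : √(N:ℝ) ^ 2 = N := Real.sq_sqrt hNpos.le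
      rw [integral_scale _ _ (by positivity) (by positivity), integral_indicator (hBm.inter (hA N))]
      congr 1
      rw [inv_inv, inv_inv]
      linear_combination (N:ℝ) * hs
    refine Tendsto.congr' hF ?_
    refine tendsto_integral_filter_of_dominated_convergence
      (fun p => Real.exp (-(1/10000) * p.1 ^ 2) * Real.exp (-(1/10000) * p.2 ^ 2)) ?_ ?_
      (gauss_integrable _ _ (by norm_num) (by norm_num)) ?_
    · refine Eventually.of_forall fun N => ?_
      apply Measurable.aestronglyMeasurable
      exact ((PC_cont N).measurable.indicator (hBm.inter (hA N))).comp (by fun_prop)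
    · filter_upwards [eventually_ge_atTop 2] with N hN
      refine Eventually.of_forall fun p => ?_
      have hNpos : (0:ℝ) < N := by positivity
      have hs0 : 0 < √(N:ℝ) := (Real.sqrt_pos.mpr hNpos)
      have hs : √(N:ℝ) ^ 2 = N := Real.sq_sqrt hNpos.le
      simp only [F]
      by_cases hm : ((√N)⁻¹ * p.1, (N * √N : ℝ)⁻¹ * p.2) ∈ Bx ∩ A N
      · rw [Set.indicator_of_mem hm, Real.norm_eq_abs]
        refine (PC_A N hN _ ((mem_Bx _).mp hm.1).1 hm.2).trans ?_
        apply le_of_eq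
        congr 2
        · simp only; rw [mul_pow, inv_pow, hs]; field_simp
        · simp only; rw [mul_pow, inv_pow, mul_pow, hs]; field_simp
      · rw [Set.indicator_of_notMem hm, norm_zero]; positivity
    · refine Eventually.of_forall fun p => ?_
      refine (PC_lim p.1 p.2).congr' ?_
      obtain ⟨M, hM⟩ := exists_nat_gt ((|p.1| + |p.2|) ^ 2)
      filter_upwards [eventually_ge_atTop 2, eventually_ge_atTop M] with N hN hNM
      have hNpos : (0:ℝ) < N := by positivity
      have hs0 : 0 < √(N:ℝ) := (Real.sqrt_pos.mpr hNpos)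
      have hs : √(N:ℝ) ^ 2 = N := Real.sq_sqrt hNpos.le
      have hKN : |p.1| + |p.2| ≤ √N := by
        apply Real.le_sqrt_of_sq_le
        have : (M:ℝ) ≤ N := by exact_mod_cast hNM
        linarith
      have hpi := Real.pi_gt_three
      have hx : |(√N)⁻¹ * p.1| ≤ 1 := by
        rw [abs_mul, abs_of_pos (by positivity), inv_mul_le_one₀ hs0]
        linarith [abs_nonneg p.2]
      have hy : |(N * √N : ℝ)⁻¹ * p.2| ≤ 1 / N := by
        rw [abs_mul, abs_of_pos (by positivity), mul_inv, mul_assoc, one_div]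
        apply mul_le_of_le_one_right (by positivity)
        rw [inv_mul_le_one₀ hs0]
        linarith [abs_nonneg p.1]
      have hN1 : 1 / (N:ℝ) ≤ 1 := by
        rw [div_le_one hNpos]; exact_mod_cast (by omega : 1 ≤ N)
      simp only [F]
      rw [Set.indicator_of_mem]
      refine ⟨(mem_Bx _).mpr ⟨by simp only; linarith, by simp only; linarith⟩, ?_⟩
      show |(N * √N : ℝ)⁻¹ * p.2| ≤ Real.pi / N
      refine hy.trans ?_
      gcongr; linarith
  have h2 : Tendsto (fun N : ℕ => (N:ℝ) ^ 2 * ∫ p in Bx \ A N, PC N p.1 p.2) atTop (nhds 0) := by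
    have hb : Tendsto (fun N : ℕ => Real.pi ^ 2 * 64 * (((N:ℝ) / 8) ^ 2 * Real.exp (-((N:ℝ) / 8)))) atTop
        (nhds 0) := by
      have h := Real.tendsto_pow_mul_exp_neg_atTop_nhds_zero 2
      have h' : Tendsto (fun N : ℕ => (N:ℝ) / 8) atTop atTop :=
        tendsto_natCast_atTop_atTop.atTop_div_const (by norm_num)
      simpa using (h.comp h').const_mul (Real.pi ^ 2 * 64)
    apply squeeze_zero_norm' _ hb
    filter_upwards [eventually_ge_atTop 2] with N hN
    have hvol : (volume : Measure (ℝ × ℝ)).real (Bx \ A N) ≤ Real.pi ^ 2 := by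
      rw [← Bx_vol]
      exact measureReal_mono Set.sdiff_subset Bx_compact.measure_lt_top.ne
    have : ‖∫ p in Bx \ A N, PC N p.1 p.2‖ ≤ Real.exp (-(N:ℝ)/8) * (volume : Measure (ℝ × ℝ)).real (Bx \ A N) := by
      apply norm_setIntegral_le_of_norm_le_const
      · exact (measure_mono Set.sdiff_subset).trans_lt Bx_compact.measure_lt_top
      · intro p hp
        exact PC_B N hN p ((mem_Bx p).mp hp.1).2 (le_of_lt (not_le.mp hp.2))
    rw [norm_mul, norm_pow, Real.norm_natCast]
    have h3 := mul_le_mul_of_nonneg_left hvol (Real.exp_pos (-(N:ℝ)/8)).le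
    have h4 := mul_le_mul_of_nonneg_left (this.trans h3) (sq_nonneg (N:ℝ))
    refine h4.trans (le_of_eq ?_)
    rw [neg_div]; ring
  have := h1.add h2
  rw [add_zero] at this
  refine this.congr fun N => ?_
  rw [← mul_add, integral_inter_add_sdiff (hA N) (hPI N)]

open Filter

/-- sign vectors -/
def Sg (ι : Type*) [Fintype ι] [DecidableEq ι] : Finset (ι → ℤ) :=
  Fintype.piFinset fun _ => ({1, -1} : Finset ℤ)

lemma mem_Sg {ι : Type*} [Fintype ι] [DecidableEq ι] (a : ι → ℤ) :
    a ∈ Sg ι ↔ ∀ i, a i = 1 ∨ a i = -1 := by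
  simp [Sg, Fintype.mem_piFinset]

lemma card_Sg (ι : Type*) [Fintype ι] [DecidableEq ι] : (Sg ι).card = 2 ^ Fintype.card ι := by
  simp [Sg, Fintype.card_piFinset]

/-- vectors with given sum and weighted sum -/
def St (m : ℕ) (s t : ℤ) : Finset (Fin m → ℤ) :=
  (Sg (Fin m)).filter fun a => ∑ i, a i = s ∧ ∑ i : Fin m, ((i : ℕ) : ℤ) * a i = t

lemma int_single (k : ℤ) (hk : 2 ∣ k) :
    ∫ x in Set.Icc (-(Real.pi / 2)) (Real.pi / 2), Complex.exp (Complex.I * x * k) =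
      if k = 0 then (Real.pi : ℂ) else 0 := by
  rw [MeasureTheory.integral_Icc_eq_integral_Ioc,
    ← intervalIntegral.integral_of_le (by linarith [Real.pi_pos])]
  split_ifs with h
  · subst h
    simp
  · obtain ⟨l, rfl⟩ := hk
    have hl : (l : ℂ) ≠ 0 := by
      intro h0; apply h; have : l = 0 := by exact_mod_cast h0
      simp [this]
    have hc : (2 * l * Complex.I : ℂ) ≠ 0 := by
      simp [hl]
    have := integral_exp_mul_complex (a := -(Real.pi / 2)) (b := Real.pi / 2) hc
    rw [show (fun x : ℝ => Complex.exp (Complex.I * x * ((2 * l : ℤ) : ℂ))) =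
      fun x : ℝ => Complex.exp (2 * l * Complex.I * x) by
        funext x; congr 1; push_cast; ring]
    rw [this]
    have e : Complex.exp (2 * l * Complex.I * ((Real.pi / 2 : ℝ) : ℂ)) =
        Complex.exp (2 * l * Complex.I * ((-(Real.pi / 2) : ℝ) : ℂ)) := by
      rw [Complex.exp_eq_exp_iff_exists_int]
      refine ⟨l, ?_⟩
      push_cast; ring
    rw [e, sub_self, zero_div]

lemma sum_Sg_exp (m : ℕ) (x y : ℝ) :
    ∑ a ∈ Sg (Fin m), Complex.exp (Complex.I * x * ((∑ i, a i : ℤ) : ℂ)) *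
      Complex.exp (Complex.I * y * ((∑ i : Fin m, ((i : ℕ) : ℤ) * a i : ℤ) : ℂ)) = 2 ^ m * (PC m x y : ℂ) := by
  have h1 : ∀ a : Fin m → ℤ, Complex.exp (Complex.I * x * ((∑ i, a i : ℤ) : ℂ)) *
      Complex.exp (Complex.I * y * ((∑ i : Fin m, ((i : ℕ) : ℤ) * a i : ℤ) : ℂ)) =
      ∏ i : Fin m, Complex.exp (Complex.I * (x + (i : ℕ) * y) * (a i : ℂ)) := by
    intro a
    rw [← Complex.exp_add, ← Complex.exp_sum]
    congr 1
    push_cast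
    rw [Finset.mul_sum, Finset.mul_sum, ← Finset.sum_add_distrib]
    apply Finset.sum_congr rfl
    intro i _
    ring
  simp_rw [h1]
  unfold Sg
  rw [Finset.sum_prod_piFinset ({1, -1} : Finset ℤ)
    (fun (i : Fin m) (e : ℤ) => Complex.exp (Complex.I * (x + (i : ℕ) * y) * (e : ℂ)))]
  have h2 : ∀ i : Fin m, ∑ e ∈ ({1, -1} : Finset ℤ), Complex.exp (Complex.I * (x + (i : ℕ) * y) * (e : ℂ))
      = 2 * Complex.cos (x + (i : ℕ) * y) := by
    intro i
    rw [Finset.sum_pair (by norm_num), Complex.two_cos]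
    push_cast
    congr 2 <;> ring
  simp_rw [h2]
  rw [Finset.prod_mul_distrib, Finset.prod_const, Finset.card_univ, Fintype.card_fin]
  congr 1
  unfold PC
  push_cast
  rw [Fin.prod_univ_eq_prod_range (fun j : ℕ => Complex.cos (x + j * y)) m]

open MeasureTheory in
lemma St_card (m : ℕ) (s t : ℤ) (hs : ∀ a ∈ Sg (Fin m), 2 ∣ (∑ i, a i) - s)
    (ht : ∀ a ∈ Sg (Fin m), 2 ∣ (∑ i : Fin m, ((i : ℕ) : ℤ) * a i) - t) :
    ((St m s t).card : ℂ) * Real.pi ^ 2 = ∫ p in Bx, 2 ^ m * (PC m p.1 p.2 : ℂ) *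
      (Complex.exp (-(Complex.I * p.1 * s)) * Complex.exp (-(Complex.I * p.2 * t))) := by
  have h1 : ∀ a ∈ Sg (Fin m), ∫ p in Bx, Complex.exp (Complex.I * (p.1 : ℝ) * (((∑ i, a i) - s : ℤ) : ℂ)) *
      Complex.exp (Complex.I * (p.2 : ℝ) * (((∑ i : Fin m, ((i : ℕ) : ℤ) * a i) - t : ℤ) : ℂ)) =
      if (∑ i, a i = s ∧ ∑ i : Fin m, ((i : ℕ) : ℤ) * a i = t) then (Real.pi : ℂ) ^ 2 else 0 := by
    intro a ha
    unfold Bx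
    rw [Measure.volume_eq_prod]
    rw [setIntegral_prod_mul (fun x : ℝ => Complex.exp (Complex.I * x * (((∑ i, a i) - s : ℤ) : ℂ)))
      (fun y : ℝ => Complex.exp (Complex.I * y * (((∑ i : Fin m, ((i : ℕ) : ℤ) * a i) - t : ℤ) : ℂ))),
      int_single _ (hs a ha), int_single _ (ht a ha)]
    simp only [sub_eq_zero]
    by_cases h1 : ∑ i, a i = s <;> by_cases h2 : ∑ i : Fin m, ((i : ℕ) : ℤ) * a i = t <;> simp [h1, h2, sq]
  have h2 : ((St m s t).card : ℂ) * Real.pi ^ 2 = ∑ a ∈ Sg (Fin m),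
      if (∑ i, a i = s ∧ ∑ i : Fin m, ((i : ℕ) : ℤ) * a i = t) then (Real.pi : ℂ) ^ 2 else 0 := by
    rw [← Finset.sum_filter, Finset.sum_const, nsmul_eq_mul]; rfl
  rw [h2, ← Finset.sum_congr rfl h1, ← integral_finset_sum]
  · congr 1
    funext p
    rw [← sum_Sg_exp, Finset.sum_mul]
    apply Finset.sum_congr rfl
    intro a _
    rw [← Complex.exp_add, ← Complex.exp_add, ← Complex.exp_add, ← Complex.exp_add]
    congr 1
    push_cast
    ring
  · intro a _
    exact ContinuousOn.integrableOn_compact Bx_compact (Continuous.continuousOn (by fun_prop))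

lemma sum_even_diff {m : ℕ} (w : Fin m → ℤ) (a b : Fin m → ℤ) (ha : a ∈ Sg (Fin m)) (hb : b ∈ Sg (Fin m)) :
    2 ∣ (∑ i, w i * a i) - ∑ i, w i * b i := by
  rw [← Finset.sum_sub_distrib]
  apply Finset.dvd_sum
  intro i _
  rw [← mul_sub]
  apply Dvd.dvd.mul_left
  rw [mem_Sg] at ha hb
  rcases ha i with h | h <;> rcases hb i with h' | h' <;> rw [h, h'] <;> norm_num

open MeasureTheory in
lemma St_bound0 (m : ℕ) (s t : ℤ) :
    ((St m s t).card : ℝ) * Real.pi ^ 2 ≤ 2 ^ m * ∫ p in Bx, |PC m p.1 p.2| := by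
  rcases Finset.eq_empty_or_nonempty (St m s t) with h | ⟨b, hb⟩
  · rw [h]; simp
    apply integral_nonneg; intro p; positivity
  · simp only [St, Finset.mem_filter] at hb
    obtain ⟨hb, h1, h2⟩ := hb
    have key := St_card m s t (fun a ha => by
      have := sum_even_diff (fun _ => 1) a b ha hb
      simpa [h1] using this) (fun a ha => by
      have := sum_even_diff (fun i => ((i:ℕ):ℤ)) a b ha hb
      rwa [h2] at this)
    have hn := congrArg norm key
    rw [norm_mul, norm_pow, Complex.norm_real, Complex.norm_natCast, Real.norm_eq_abs, sq_abs] at hn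
    rw [hn, ← integral_const_mul]
    refine (norm_integral_le_integral_norm _).trans (le_of_eq ?_)
    congr 1
    funext p
    rw [norm_mul, norm_mul, norm_mul, norm_pow, Complex.norm_real, Complex.norm_ofNat]
    have e1 := Complex.norm_exp_ofReal_mul_I (-(p.1 * s))
    have e2 := Complex.norm_exp_ofReal_mul_I (-(p.2 * t))
    rw [show -(Complex.I * p.1 * s) = ((-(p.1 * s) : ℝ) : ℂ) * Complex.I by push_cast; ring,
      show -(Complex.I * p.2 * t) = ((-(p.2 * t) : ℝ) : ℂ) * Complex.I by push_cast; ring, e1, e2]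
    simp

lemma St_bound : ∃ C : ℝ, 0 < C ∧ ∀ m : ℕ, 1 ≤ m → ∀ s t : ℤ,
    ((St m s t).card : ℝ) ≤ C / m ^ 2 * 2 ^ m := by
  refine ⟨20000, by norm_num, fun m hm s t => ?_⟩
  have hmpos : (0:ℝ) < m := by exact_mod_cast hm
  have hpi := Real.pi_gt_three
  rcases Nat.lt_or_ge m 2 with h | h
  · have : m = 1 := by omega
    subst this
    have h1 : (St 1 s t).card ≤ 2 := by
      unfold St
      refine (Finset.card_filter_le _ _).trans ?_
      rw [card_Sg]; simp
    have : ((St 1 s t).card : ℝ) ≤ 2 := by exact_mod_cast h1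
    norm_num; linarith
  · have h1 := (St_bound0 m s t).trans (mul_le_mul_of_nonneg_left (PC_bound m h) (by positivity))
    have h2 : Real.exp (-(m:ℝ)/8) ≤ 128 / m ^ 2 := by
      have := Real.quadratic_le_exp_of_nonneg (x := (m:ℝ)/8) (by positivity)
      rw [neg_div, Real.exp_neg]
      rw [inv_le_comm₀ (Real.exp_pos _) (by positivity), inv_div]
      nlinarith
    have h3 : 10000 * Real.pi / m ^ 2 + Real.pi ^ 2 * Real.exp (-(m:ℝ)/8) ≤ (20000 / m ^ 2) * Real.pi ^ 2 := by
      calc _ ≤ 10000 * Real.pi / m ^ 2 + Real.pi ^ 2 * (128 / m ^ 2) := by gcongr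
        _ = (10000 * Real.pi + 128 * Real.pi ^ 2) / m ^ 2 := by ring
        _ ≤ (20000 * Real.pi ^ 2) / m ^ 2 := by gcongr; nlinarith
        _ = _ := by ring
    have h4 := h1.trans (mul_le_mul_of_nonneg_left h3 (by positivity))
    have h5 : 0 < Real.pi ^ 2 := by positivity
    apply le_of_mul_le_mul_right _ h5
    linarith

lemma St_zero (m : ℕ) (hm : 4 ∣ m) :
    ((St m 0 0).card : ℝ) * Real.pi ^ 2 = 2 ^ m * ∫ p in Bx, PC m p.1 p.2 := by
  have hone : (fun _ => 1 : Fin m → ℤ) ∈ Sg (Fin m) := by rw [mem_Sg]; simp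
  obtain ⟨q, rfl⟩ := hm
  have key := St_card (4 * q) 0 0 (fun a ha => by
      have := sum_even_diff (fun _ => 1) a _ ha hone
      have h2 := (dvd_add this (⟨2 * q, by simp; ring⟩ : (2:ℤ) ∣ ∑ i : Fin (4 * q), 1 * 1))
      simpa using h2) (fun a ha => by
      have := sum_even_diff (fun i => ((i:ℕ):ℤ)) a _ ha hone
      have h1 : ∑ i : Fin (4 * q), ((i:ℕ):ℤ) * 1 = 2 * (q * (4 * q - 1)) := by
        have : ∀ n : ℕ, 2 * ∑ i ∈ Finset.range n, (i:ℤ) = n * (n - 1) := by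
          intro n
          induction n with
          | zero => simp
          | succ k ih => rw [Finset.sum_range_succ, mul_add, ih]; push_cast; ring
        have h3 := this (4 * q)
        simp_rw [mul_one]
        rw [Fin.sum_univ_eq_sum_range (fun i : ℕ => (i:ℤ))]
        push_cast at h3
        linarith
      rw [h1] at this
      have h2 := dvd_add this (⟨_, rfl⟩ : (2:ℤ) ∣ 2 * (q * (4 * q - 1)))
      simpa using h2)
  simp only [Int.cast_zero, mul_zero, neg_zero, Complex.exp_zero, mul_one] at key
  rw [← MeasureTheory.integral_const_mul]
  have h2 : (∫ p in Bx, (2:ℂ) ^ (4 * q) * (PC (4 * q) p.1 p.2 : ℂ)) =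
      ((∫ p in Bx, 2 ^ (4 * q) * PC (4 * q) p.1 p.2 : ℝ) : ℂ) := by
    rw [← integral_complex_ofReal]; congr 1; funext p; push_cast; rfl
  rw [h2] at key
  exact_mod_cast key

lemma St_lim : Tendsto (fun N : ℕ => (N:ℝ) ^ 2 * (St N 0 0).card / 2 ^ N)
    (atTop ⊓ Filter.principal {N : ℕ | 4 ∣ N}) (nhds (4 * √3 / Real.pi)) := by
  have h := (PC_int_lim.div_const (Real.pi ^ 2)).mono_left
    (inf_le_left : atTop ⊓ Filter.principal {N : ℕ | 4 ∣ N} ≤ atTop)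
  have e : 4 * Real.pi * √3 / Real.pi ^ 2 = 4 * √3 / Real.pi := by
    field_simp
  rw [e] at h
  refine h.congr' ?_
  filter_upwards [Filter.mem_inf_of_right (Filter.mem_principal_self _)] with N hN
  have := St_zero N hN
  have h2 : (0:ℝ) < 2 ^ N := by positivity
  field_simp
  linear_combination (-(N:ℝ) ^ 2) * this

open Filter

section comb
variable {ι : Type*} [Fintype ι] [DecidableEq ι]

lemma card_le_of_fibers (A : Finset (ι → ℤ)) (hA : A ⊆ Sg ι) (I : Finset ι) (B : ℕ)
    (h : ∀ b ∈ A, (A.filter fun a => ∀ i, i ∉ I → a i = b i).card ≤ B) :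
    A.card ≤ B * 2 ^ (Fintype.card ι - I.card) := by
  classical
  let φ : (ι → ℤ) → (ι → ℤ) := fun a i => if i ∈ I then 1 else a i
  have h1 : A.card ≤ B * (A.image φ).card := by
    apply Finset.card_le_mul_card_image
    intro c hc
    obtain ⟨b, hb, rfl⟩ := Finset.mem_image.mp hc
    refine le_trans (Finset.card_le_card ?_) (h b hb)
    intro a ha
    rw [Finset.mem_filter] at ha ⊢
    refine ⟨ha.1, fun i hi => ?_⟩
    have := congrFun ha.2 i
    simpa [φ, hi] using this
  refine h1.trans (Nat.mul_le_mul_left _ ?_)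
  have h2 : A.image φ ⊆ Fintype.piFinset fun i => if i ∈ I then ({1} : Finset ℤ) else {1, -1} := by
    intro c hc
    obtain ⟨a, ha, rfl⟩ := Finset.mem_image.mp hc
    rw [Fintype.mem_piFinset]
    intro i
    have := (mem_Sg a).mp (hA ha) i
    by_cases hi : i ∈ I
    · simp [φ, hi]
    · simpa [φ, hi] using this
  refine (Finset.card_le_card h2).trans (le_of_eq ?_)
  rw [Fintype.card_piFinset]
  have h3 : ∀ i, (if i ∈ I then ({1} : Finset ℤ) else {1, -1}).card = if i ∈ I then 1 else 2 := by
    intro i; split_ifs <;> rfl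
  simp_rw [h3]
  rw [Finset.prod_ite]
  simp only [Finset.prod_const_one, one_mul, Finset.prod_const]
  congr 1
  rw [Finset.filter_notMem_eq_sdiff, Finset.card_sdiff_of_subset (Finset.subset_univ _), Finset.card_univ]

lemma card_le_of_inj (A : Finset (ι → ℤ)) (hA : A ⊆ Sg ι) (I : Finset ι)
    (h : ∀ a ∈ A, ∀ b ∈ A, (∀ i, i ∉ I → a i = b i) → a = b) :
    A.card ≤ 2 ^ (Fintype.card ι - I.card) := by
  have := card_le_of_fibers A hA I 1 (fun b hb => by
    rw [Finset.card_le_one]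
    intro a ha a' ha'
    rw [Finset.mem_filter] at ha ha'
    rw [h a ha.1 b hb ha.2, h a' ha'.1 b hb ha'.2])
  simpa using this

lemma fiber_St {m : ℕ} (e : Fin m → ι) (b : ι → ℤ) (s t : ℤ) (A : Finset (ι → ℤ)) (hA : A ⊆ Sg ι)
    (h1 : ∀ a ∈ A, ∀ i, i ∉ Set.range e → a i = b i)
    (h2 : ∀ a ∈ A, ∑ i, a (e i) = s) (h3 : ∀ a ∈ A, ∑ i : Fin m, ((i:ℕ):ℤ) * a (e i) = t) :
    A.card ≤ (St m s t).card := by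
  apply Finset.card_le_card_of_injOn (fun a => a ∘ e)
  · intro a ha
    simp only [St, Finset.coe_filter, Set.mem_setOf_eq]
    refine ⟨?_, h2 a ha, h3 a ha⟩
    rw [mem_Sg]
    intro i
    exact (mem_Sg a).mp (hA ha) (e i)
  · intro a ha a' ha' he
    funext i
    by_cases hi : i ∈ Set.range e
    · obtain ⟨j, rfl⟩ := hi
      exact congrFun he j
    · rw [h1 a ha i hi, h1 a' ha' i hi]

lemma two_classes {m W : ℕ} (hW : ∀ s t, (St m s t).card ≤ W) (e0 e1 : Fin m → ι)
    (he0 : Function.Injective e0) (he1 : Function.Injective e1) (hd : ∀ i j, e0 i ≠ e1 j)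
    (A : Finset (ι → ℤ)) (hA : A ⊆ Sg ι)
    (h : ∀ a ∈ A, ∀ b ∈ A, (∀ i, i ∉ Set.range e0 → i ∉ Set.range e1 → a i = b i) →
      (∑ i, a (e0 i) = ∑ i, b (e0 i)) ∧ (∑ i, a (e1 i) = ∑ i, b (e1 i)) ∧
      (∑ i : Fin m, ((i:ℕ):ℤ) * a (e0 i) = ∑ i : Fin m, ((i:ℕ):ℤ) * b (e0 i)) ∧
      (∑ i : Fin m, ((i:ℕ):ℤ) * a (e1 i) = ∑ i : Fin m, ((i:ℕ):ℤ) * b (e1 i))) :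
    A.card ≤ W * W * 2 ^ (Fintype.card ι - 2 * m) := by
  classical
  have hI : (Finset.univ.image e0 ∪ Finset.univ.image e1).card = 2 * m := by
    rw [Finset.card_union_of_disjoint, Finset.card_image_of_injective _ he0,
      Finset.card_image_of_injective _ he1, Finset.card_univ, Fintype.card_fin]
    · ring
    · rw [Finset.disjoint_left]
      intro x hx hx'
      obtain ⟨i, -, rfl⟩ := Finset.mem_image.mp hx
      obtain ⟨j, -, hj⟩ := Finset.mem_image.mp hx'
      exact hd i j hj.symm
  rw [← hI]
  apply card_le_of_fibers A hA
  intro b hb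
  set F := A.filter fun a => ∀ i, i ∉ Finset.univ.image e0 ∪ Finset.univ.image e1 → a i = b i with hF
  have hFp : ∀ a ∈ F, a ∈ A ∧ ∀ i, i ∉ Set.range e0 → i ∉ Set.range e1 → a i = b i := by
    intro a ha
    rw [hF, Finset.mem_filter] at ha
    refine ⟨ha.1, fun i h0 h1 => ha.2 i ?_⟩
    simp only [Finset.mem_union, Finset.mem_image, Finset.mem_univ, true_and, not_or]
    exact ⟨h0, h1⟩
  let φ : (ι → ℤ) → (ι → ℤ) := fun a i => if i ∈ Set.range e0 then 1 else a i
  have h1 : F.card ≤ W * (F.image φ).card := by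
    apply Finset.card_le_mul_card_image
    intro c hc
    obtain ⟨c, hc, rfl⟩ := Finset.mem_image.mp hc
    refine (fiber_St e0 c (∑ i, b (e0 i)) (∑ i : Fin m, ((i:ℕ):ℤ) * b (e0 i)) _ ?_ ?_ ?_ ?_).trans (hW _ _)
    · intro a ha
      exact hA (hFp a (Finset.mem_filter.mp ha).1).1
    · intro a ha i hi
      have := congrFun (Finset.mem_filter.mp ha).2 i
      simp only [φ, if_neg hi] at this
      exact this
    · intro a ha
      have := hFp a (Finset.mem_filter.mp ha).1
      exact (h a this.1 b hb this.2).1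
    · intro a ha
      have := hFp a (Finset.mem_filter.mp ha).1
      exact (h a this.1 b hb this.2).2.2.1
  refine h1.trans (Nat.mul_le_mul_left _ ?_)
  have hφ : ∀ a j, φ a (e1 j) = a (e1 j) := by
    intro a j
    have : e1 j ∉ Set.range e0 := by rintro ⟨i, hi⟩; exact hd i j hi
    simp only [φ, if_neg this]
  refine (fiber_St e1 (φ b) (∑ i, b (e1 i)) (∑ i : Fin m, ((i:ℕ):ℤ) * b (e1 i)) _ ?_ ?_ ?_ ?_).trans (hW _ _)
  · intro c hc
    obtain ⟨a, ha, rfl⟩ := Finset.mem_image.mp hc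
    rw [mem_Sg]
    intro i
    have := (mem_Sg a).mp (hA (hFp a ha).1) i
    simp only [φ]
    split_ifs
    · left; rfl
    · exact this
  · intro c hc i hi
    obtain ⟨a, ha, rfl⟩ := Finset.mem_image.mp hc
    simp only [φ]
    split_ifs with h0
    · rfl
    · exact (hFp a ha).2 i h0 hi
  · intro c hc
    obtain ⟨a, ha, rfl⟩ := Finset.mem_image.mp hc
    simp only [hφ]
    exact (h a (hFp a ha).1 b hb (hFp a ha).2).2.1
  · intro c hc
    obtain ⟨a, ha, rfl⟩ := Finset.mem_image.mp hc
    simp only [hφ]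
    exact (h a (hFp a ha).1 b hb (hFp a ha).2).2.2.2
end comb

/-- Sum over `Fin N` of a function supported on the two progressions. -/
lemma sum_two_prog {M : Type*} [AddCommMonoid M] {N m : ℕ} (e0 e1 : Fin m → Fin N)
    (he0 : Function.Injective e0) (he1 : Function.Injective e1) (hd : ∀ i j, e0 i ≠ e1 j)
    (g : Fin N → M) (hg : ∀ i, i ∉ Set.range e0 → i ∉ Set.range e1 → g i = 0) :
    ∑ j, g j = ∑ i, g (e0 i) + ∑ i, g (e1 i) := by
  classical
  rw [← Finset.sum_image (s := Finset.univ) (g := e0) (f := g) (fun a _ b _ h => he0 h),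
    ← Finset.sum_image (s := Finset.univ) (g := e1) (f := g) (fun a _ b _ h => he1 h),
    ← Finset.sum_union]
  · symm
    apply Finset.sum_subset (Finset.subset_univ _)
    intro x _ hx
    apply hg
    · rintro ⟨i, rfl⟩; apply hx; simp
    · rintro ⟨i, rfl⟩; apply hx; simp
  · rw [Finset.disjoint_left]
    intro x hx hx'
    obtain ⟨i, -, rfl⟩ := Finset.mem_image.mp hx
    obtain ⟨j, -, hj⟩ := Finset.mem_image.mp hx'
    exact hd i j hj.symm

def prog (N d m : ℕ) (r : ℕ) (hr : r < d) (hm : d * m ≤ N) : Fin m → Fin N := fun i =>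
  ⟨r + d * i, by
    have : d * (i + 1) ≤ d * m := Nat.mul_le_mul_left _ i.2
    rw [mul_add] at this
    omega⟩

lemma prog_inj (N d m r : ℕ) (hr : r < d) (hm : d * m ≤ N) : Function.Injective (prog N d m r hr hm) := by
  intro i j h
  simp only [prog, Fin.mk.injEq] at h
  have h1 : d * (i:ℕ) = d * j := by omega
  exact Fin.ext (Nat.eq_of_mul_eq_mul_left (by omega) h1)

lemma prog_disj (N d m : ℕ) (hd : 1 < d) (hm : d * m ≤ N) (i j : Fin m) :
    prog N d m 0 (by omega) hm i ≠ prog N d m 1 hd hm j := by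
  intro h
  simp only [prog, Fin.mk.injEq] at h
  have := congrArg (· % d) h
  simp [Nat.mod_eq_of_lt hd] at this

/-- General count for the double root at a nonreal root of unity. -/
lemma count_unity {N d m W : ℕ} (hd : 1 < d) (hm : d * m ≤ N) (hW : ∀ s t, (St m s t).card ≤ W)
    (z : ℂ) (hz : z ^ d = 1) (him : z.im ≠ 0) (A : Finset (Fin N → ℤ)) (hA : A ⊆ Sg (Fin N))
    (h1 : ∀ a ∈ A, ∑ j : Fin N, (a j : ℂ) * z ^ (j:ℕ) = 0)
    (h2 : ∀ a ∈ A, ∑ j : Fin N, ((j:ℕ):ℂ) * (a j : ℂ) * z ^ (j:ℕ) = 0) :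
    A.card ≤ W * W * 2 ^ (N - 2 * m) := by
  have key := two_classes hW (prog N d m 0 (by omega) hm) (prog N d m 1 hd hm)
    (prog_inj _ _ _ _ _ _) (prog_inj _ _ _ _ _ _) (prog_disj N d m hd hm) A hA ?_
  · simpa using key
  intro a ha b hb hab
  have hs := sum_two_prog (prog N d m 0 (by omega) hm) (prog N d m 1 hd hm)
    (prog_inj _ _ _ _ _ _) (prog_inj _ _ _ _ _ _) (prog_disj N d m hd hm) (M := ℂ)
  have hlin : ∀ x y : ℤ, (x : ℂ) + y * z = 0 → x = 0 ∧ y = 0 := by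
    intro x y hxy
    have hi := congrArg Complex.im hxy
    simp [him] at hi
    subst hi
    simp at hxy
    exact ⟨hxy, rfl⟩
  have hz0 : ∀ i : Fin m, z ^ ((prog N d m 0 (by omega) hm i : Fin N) : ℕ) = 1 := by
    intro i; simp [prog, pow_mul, hz]
  have hz1 : ∀ i : Fin m, z ^ ((prog N d m 1 hd hm i : Fin N) : ℕ) = z := by
    intro i; simp [prog, pow_add, pow_mul, hz]
  have E1 : ∑ j : Fin N, ((a j - b j : ℤ) : ℂ) * z ^ (j:ℕ) = 0 := by
    have := h1 a ha; have h' := h1 b hb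
    push_cast
    simp_rw [sub_mul]
    rw [Finset.sum_sub_distrib, this, h', sub_zero]
  have E2 : ∑ j : Fin N, ((j:ℕ):ℂ) * ((a j - b j : ℤ) : ℂ) * z ^ (j:ℕ) = 0 := by
    have := h2 a ha; have h' := h2 b hb
    push_cast
    simp_rw [mul_sub, sub_mul]
    rw [Finset.sum_sub_distrib, this, h', sub_zero]
  rw [hs _ (fun i hi hi' => by rw [hab i hi hi']; simp)] at E1 E2
  simp_rw [hz0, hz1, mul_one] at E1 E2
  rw [← Finset.sum_mul] at E1 E2
  obtain ⟨A0, A1⟩ := hlin (∑ i, (a (prog N d m 0 (by omega) hm i) - b (prog N d m 0 (by omega) hm i)))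
    (∑ i, (a (prog N d m 1 hd hm i) - b (prog N d m 1 hd hm i))) (by push_cast at E1 ⊢; exact E1)
  obtain ⟨B0, B1⟩ := hlin
    (∑ i, ((prog N d m 0 (by omega) hm i : Fin N) : ℕ) * (a (prog N d m 0 (by omega) hm i) - b (prog N d m 0 (by omega) hm i)))
    (∑ i, ((prog N d m 1 hd hm i : Fin N) : ℕ) * (a (prog N d m 1 hd hm i) - b (prog N d m 1 hd hm i)))
      (by push_cast at E2 ⊢; exact E2)
  have hdz : (d:ℤ) ≠ 0 := by omega
  have C0 : ∑ i : Fin m, ((i:ℕ):ℤ) * (a (prog N d m 0 (by omega) hm i) - b (prog N d m 0 (by omega) hm i)) = 0 := by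
    have : (d:ℤ) * ∑ i : Fin m, ((i:ℕ):ℤ) * (a (prog N d m 0 (by omega) hm i) - b (prog N d m 0 (by omega) hm i)) = 0 := by
      rw [← B0, Finset.mul_sum]
      apply Finset.sum_congr rfl
      intro i _
      simp only [prog]; push_cast; ring
    exact (mul_eq_zero.mp this).resolve_left hdz
  have C1 : ∑ i : Fin m, ((i:ℕ):ℤ) * (a (prog N d m 1 hd hm i) - b (prog N d m 1 hd hm i)) = 0 := by
    have : (d:ℤ) * ∑ i : Fin m, ((i:ℕ):ℤ) * (a (prog N d m 1 hd hm i) - b (prog N d m 1 hd hm i)) = 0 := by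
      have e : (d:ℤ) * ∑ i : Fin m, ((i:ℕ):ℤ) * (a (prog N d m 1 hd hm i) - b (prog N d m 1 hd hm i)) =
          ∑ i, ((prog N d m 1 hd hm i : Fin N) : ℕ) * (a (prog N d m 1 hd hm i) - b (prog N d m 1 hd hm i))
          - ∑ i, (a (prog N d m 1 hd hm i) - b (prog N d m 1 hd hm i)) := by
        rw [Finset.mul_sum, ← Finset.sum_sub_distrib]
        apply Finset.sum_congr rfl
        intro i _
        simp only [prog]; push_cast; ring
      rw [e, B1, A1, sub_zero]
    exact (mul_eq_zero.mp this).resolve_left hdz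
  simp_rw [mul_sub] at C0 C1
  rw [Finset.sum_sub_distrib, sub_eq_zero] at A0 A1 C0 C1
  exact ⟨A0, A1, C0, C1⟩

/-- count for `1` and `-1` both double roots. -/
lemma count_pm {N m W : ℕ} (hm : 2 * m ≤ N) (hW : ∀ s t, (St m s t).card ≤ W)
    (A : Finset (Fin N → ℤ)) (hA : A ⊆ Sg (Fin N))
    (h1 : ∀ a ∈ A, ∑ j : Fin N, a j = 0)
    (h2 : ∀ a ∈ A, ∑ j : Fin N, ((j:ℕ):ℤ) * a j = 0)
    (h3 : ∀ a ∈ A, ∑ j : Fin N, a j * (-1) ^ (j:ℕ) = 0)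
    (h4 : ∀ a ∈ A, ∑ j : Fin N, ((j:ℕ):ℤ) * a j * (-1) ^ (j:ℕ) = 0) :
    A.card ≤ W * W * 2 ^ (N - 2 * m) := by
  have hd : 1 < 2 := by norm_num
  have key := two_classes hW (prog N 2 m 0 (by omega) hm) (prog N 2 m 1 hd hm)
    (prog_inj _ _ _ _ _ _) (prog_inj _ _ _ _ _ _) (prog_disj N 2 m hd hm) A hA ?_
  · simpa using key
  intro a ha b hb hab
  have hs := sum_two_prog (prog N 2 m 0 (by omega) hm) (prog N 2 m 1 hd hm)
    (prog_inj _ _ _ _ _ _) (prog_inj _ _ _ _ _ _) (prog_disj N 2 m hd hm) (M := ℤ)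
  have hz0 : ∀ i : Fin m, (-1:ℤ) ^ ((prog N 2 m 0 (by omega) hm i : Fin N) : ℕ) = 1 := by
    intro i; simp [prog, pow_mul]
  have hz1 : ∀ i : Fin m, (-1:ℤ) ^ ((prog N 2 m 1 hd hm i : Fin N) : ℕ) = -1 := by
    intro i; simp [prog, pow_add, pow_mul]
  have E1 : ∑ j : Fin N, (a j - b j) = 0 := by
    rw [Finset.sum_sub_distrib, h1 a ha, h1 b hb, sub_zero]
  have E2 : ∑ j : Fin N, ((j:ℕ):ℤ) * (a j - b j) = 0 := by
    simp_rw [mul_sub]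
    rw [Finset.sum_sub_distrib, h2 a ha, h2 b hb, sub_zero]
  have E3 : ∑ j : Fin N, (a j - b j) * (-1) ^ (j:ℕ) = 0 := by
    simp_rw [sub_mul]
    rw [Finset.sum_sub_distrib, h3 a ha, h3 b hb, sub_zero]
  have E4 : ∑ j : Fin N, ((j:ℕ):ℤ) * (a j - b j) * (-1) ^ (j:ℕ) = 0 := by
    simp_rw [mul_sub, sub_mul]
    rw [Finset.sum_sub_distrib, h4 a ha, h4 b hb, sub_zero]
  rw [hs _ (fun i hi hi' => by rw [hab i hi hi']; simp)] at E1 E2 E3 E4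
  simp_rw [hz0, hz1] at E3 E4
  rw [← Finset.sum_mul, ← Finset.sum_mul] at E3 E4
  have p0 : ∀ i, (((prog N 2 m 0 (by omega) hm i : Fin N) : ℕ) : ℤ) = 2 * ((i:ℕ):ℤ) := by
    intro i; simp [prog]
  have p1 : ∀ i, (((prog N 2 m 1 hd hm i : Fin N) : ℕ) : ℤ) = 1 + 2 * ((i:ℕ):ℤ) := by
    intro i; simp [prog]
  simp_rw [p0, p1] at E2 E4
  simp only [mul_sub, add_mul, one_mul, Finset.sum_sub_distrib, Finset.sum_add_distrib, mul_assoc,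
    ← Finset.mul_sum] at E1 E2 E3 E4
  refine ⟨?_, ?_, ?_, ?_⟩ <;> linarith

open Filter

lemma sum_pow_prime_int {ι : Type*} (s : Finset ι) (y : ι → ℂ) (hy : ∀ i, IsIntegral ℤ (y i))
    {p : ℕ} (hp : p.Prime) :
    ∃ r : ℂ, IsIntegral ℤ r ∧ (∑ i ∈ s, y i) ^ p = ∑ i ∈ s, y i ^ p + p * r := by
  classical
  let Y : ι → integralClosure ℤ ℂ := fun i => ⟨y i, hy i⟩
  have key : ∃ r : integralClosure ℤ ℂ, (∑ i ∈ s, Y i) ^ p = ∑ i ∈ s, Y i ^ p + p * r := by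
    induction s using Finset.induction_on with
    | empty => exact ⟨0, by simp [hp.ne_zero]⟩
    | insert a s ha ih =>
      obtain ⟨r, hr⟩ := ih
      obtain ⟨t, ht⟩ := exists_add_pow_prime_eq hp (Y a) (∑ i ∈ s, Y i)
      refine ⟨r + Y a * (∑ i ∈ s, Y i) * t, ?_⟩
      rw [Finset.sum_insert ha, Finset.sum_insert ha, ht, hr]; ring
  obtain ⟨r, hr⟩ := key
  refine ⟨r, r.2, ?_⟩
  have := congrArg (Subtype.val) hr
  push_cast at this
  simpa [Y] using this

lemma int_of_integral_mul {p : ℕ} (hp : p ≠ 0) (u : ℤ) (r : ℂ) (hr : IsIntegral ℤ r)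
    (h : (u : ℂ) = p * r) : (p : ℤ) ∣ u := by
  have e : r = algebraMap ℚ ℂ ((u : ℚ) / p) := by
    have : (p : ℂ) ≠ 0 := by exact_mod_cast hp
    simp only [map_div₀, map_intCast, map_natCast]
    rw [h]; field_simp
  rw [e] at hr
  rw [isIntegral_algebraMap_iff (algebraMap ℚ ℂ).injective] at hr
  obtain ⟨w, hw⟩ := IsIntegrallyClosed.isIntegral_iff.mp hr
  refine ⟨w, ?_⟩
  have h2 : (p : ℚ) ≠ 0 := by exact_mod_cast hp
  have : (w : ℚ) = (u : ℚ) / p := by simpa using hw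
  field_simp at this
  have h3 : (u : ℚ) = ((p : ℤ) * w : ℤ) := by push_cast; linarith
  exact_mod_cast h3

lemma house_abs {ι : Type*} [Fintype ι] [Nonempty ι] (x : ι → ℂ) (K : ℕ)
    (hint : ∀ i, IsIntegral ℤ (x i))
    (hS : ∀ m : ℕ, ∃ s : ℤ, ∑ i, x i ^ m = s) (h0 : ∀ i, x i ≠ 0)
    (hb : ∀ i, ‖x i‖ ^ (16 * K ^ 2) < 2) (hK : Fintype.card ι ≤ K) (i : ι) :
    ∃ r : ℕ, 0 < r ∧ x i ^ r = 1 := by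
  classical
  choose S hS using hS
  set k := Fintype.card ι with hk
  have hkpos : 0 < k := Fintype.card_pos
  obtain ⟨p, hp, hp1, hp2⟩ := Nat.exists_prime_lt_and_le_two_mul (4 * k) (by omega)
  have hbe : ∀ i, ∀ e ≤ 16 * K ^ 2, ‖x i‖ ^ e ≤ 2 := by
    intro i e he
    rcases le_total ‖x i‖ 1 with h | h
    · exact (pow_le_one₀ (norm_nonneg _) h).trans (by norm_num)
    · exact (pow_le_pow_right₀ h he).trans (hb i).le
  have hSb : ∀ e ≤ 16 * K ^ 2, |S e| ≤ 2 * k := by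
    intro e he
    have h1 : ‖(S e : ℂ)‖ ≤ 2 * k := by
      rw [← hS e]
      refine (norm_sum_le _ _).trans ?_
      refine (Finset.sum_le_card_nsmul _ _ 2 (fun i _ => ?_)).trans ?_
      · rw [norm_pow]; exact hbe i e he
      · simp [hk]; linarith
    rw [Complex.norm_intCast] at h1
    exact_mod_cast h1
  have hdiv : ∀ m, (p : ℤ) ∣ S m - S (m * p) := by
    intro m
    obtain ⟨r, hr, hr2⟩ := sum_pow_prime_int Finset.univ (fun i => x i ^ m)
      (fun i => (hint i).pow m) hp
    simp only [← pow_mul] at hr2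
    rw [hS m, hS (m * p)] at hr2
    have h1 : (p : ℤ) ∣ S m ^ p - S (m * p) := by
      refine int_of_integral_mul hp.ne_zero _ r hr ?_
      push_cast; rw [hr2]; ring
    have h2 : (p : ℤ) ∣ S m ^ p - S m := by
      haveI := Fact.mk hp
      rw [← ZMod.intCast_zmod_eq_zero_iff_dvd]
      · push_cast; rw [ZMod.pow_card]; ring
    have := dvd_sub h1 h2
    simpa using this
  have hSeq : ∀ m ≤ 2 * k, S m = S (m * p) := by
    intro m hm
    have e1 : m * p ≤ 16 * K ^ 2 := by
      calc m * p ≤ (2 * k) * (2 * (4 * k)) := Nat.mul_le_mul hm hp2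
        _ = 16 * k ^ 2 := by ring
        _ ≤ _ := by gcongr
    have e2 : m ≤ 16 * K ^ 2 := le_trans (Nat.le_mul_of_pos_right m hp.pos) e1
    have b1 := abs_le.mp (hSb _ e1)
    have b2 := abs_le.mp (hSb _ e2)
    have : S m - S (m * p) = 0 := by
      apply Int.eq_zero_of_abs_lt_dvd (hdiv m)
      rw [abs_lt]; constructor <;> omega
    omega
  have hq : ∀ q : Polynomial ℂ, q.natDegree ≤ 2 * k → ∑ i, q.eval (x i) = ∑ i, q.eval (x i ^ p) := by
    intro q hq
    simp only [Polynomial.eval_eq_sum_range]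
    rw [Finset.sum_comm, Finset.sum_comm (s := Finset.univ)]
    apply Finset.sum_congr rfl
    intro m hm
    rw [← Finset.mul_sum, ← Finset.mul_sum]
    congr 1
    simp only [← pow_mul]
    rw [hS m, mul_comm p m, hS, hSeq m (by have := Finset.mem_range.mp hm; omega)]
  have hclosed : ∀ τ, ∃ σ, x σ = x τ ^ p := by
    intro τ
    by_contra hne
    push Not at hne
    set y := x τ ^ p with hy
    let T : Finset ℂ := ((Finset.univ.image x) ∪ (Finset.univ.image fun i => x i ^ p)).erase y
    let q : Polynomial ℂ := ∏ t ∈ T, (Polynomial.X - Polynomial.C t)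
    have hT : T.card ≤ 2 * k := by
      refine (Finset.card_erase_le).trans ((Finset.card_union_le _ _).trans ?_)
      have a1 := Finset.card_image_le (s := (Finset.univ : Finset ι)) (f := x)
      have a2 := Finset.card_image_le (s := (Finset.univ : Finset ι)) (f := fun i => x i ^ p)
      rw [Finset.card_univ] at a1 a2
      omega
    have hqd : q.natDegree ≤ 2 * k := by
      refine le_trans (le_of_eq ?_) hT
      simp [q, Polynomial.natDegree_prod_of_monic, Polynomial.monic_X_sub_C]
    have hqe : ∀ z, q.eval z = ∏ t ∈ T, (z - t) := by
      intro z; simp [q, Polynomial.eval_prod]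
    have hz : ∀ z ∈ T, q.eval z = 0 := by
      intro z hz; rw [hqe]; exact Finset.prod_eq_zero hz (sub_self z)
    have hqy : q.eval y ≠ 0 := by
      rw [hqe, Finset.prod_ne_zero_iff]
      intro t ht h
      exact (Finset.mem_erase.mp ht).1 (sub_eq_zero.mp h).symm
    have := hq q hqd
    rw [Finset.sum_eq_zero] at this
    · have h2 : ∑ i, q.eval (x i ^ p) = ∑ i, if x i ^ p = y then q.eval y else 0 := by
        apply Finset.sum_congr rfl
        intro i _
        split_ifs with h
        · rw [h]
        · apply hz
          apply Finset.mem_erase.mpr ⟨h, ?_⟩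
          apply Finset.mem_union_right
          exact Finset.mem_image_of_mem (fun i => x i ^ p) (Finset.mem_univ i)
      rw [h2, ← Finset.sum_filter, Finset.sum_const, nsmul_eq_mul] at this
      rcases mul_eq_zero.mp this.symm with h | h
      · have h3 : (Finset.univ.filter fun i => x i ^ p = y).card = 0 := by exact_mod_cast h
        rw [Finset.card_eq_zero] at h3
        have : τ ∈ (Finset.univ.filter fun i => x i ^ p = y) := by simp [hy]
        rw [h3] at this; simp at this
      · exact hqy h
    · intro i _
      apply hz
      apply Finset.mem_erase.mpr ⟨hne i, ?_⟩
      apply Finset.mem_union_left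
      exact Finset.mem_image_of_mem x (Finset.mem_univ i)
  have hiter : ∀ n : ℕ, ∃ σ, x σ = x i ^ (p ^ n) := by
    intro n
    induction n with
    | zero => exact ⟨i, by simp⟩
    | succ n ih =>
      obtain ⟨σ, hσ⟩ := ih
      obtain ⟨τ, hτ⟩ := hclosed σ
      exact ⟨τ, by rw [hτ, hσ, ← pow_mul, pow_succ]⟩
  choose F hF using hiter
  obtain ⟨a, b, hab, hFab⟩ := Finite.exists_ne_map_eq_of_infinite F
  have main : ∀ a b : ℕ, a < b → F a = F b → ∃ r : ℕ, 0 < r ∧ x i ^ r = 1 := by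
    intro a b hab h
    have h1 : x i ^ (p ^ a) = x i ^ (p ^ b) := by rw [← hF, ← hF, h]
    have h2 : p ^ a < p ^ b := Nat.pow_lt_pow_right hp.one_lt hab
    refine ⟨p ^ b - p ^ a, by omega, ?_⟩
    have h3 : x i ^ (p ^ b) = x i ^ (p ^ b - p ^ a) * x i ^ (p ^ a) := by
      rw [← pow_add]; congr 1; omega
    rw [h3] at h1
    have h4 : x i ^ (p ^ a) ≠ 0 := pow_ne_zero _ (h0 i)
    field_simp at h1
    exact h1.symm
  rcases lt_or_gt_of_ne hab with h | h
  · exact main a b h hFab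
  · exact main b a h hFab.symm

open IntermediateField in
lemma house (α : ℂ) (hα : IsIntegral ℤ α) (h0 : α ≠ 0) (hr : ∀ r : ℕ, 0 < r → α ^ r ≠ 1) (K : ℕ)
    (hK : (minpoly ℤ α).natDegree ≤ K) :
    ∃ β : ℂ, Polynomial.aeval β (minpoly ℤ α) = 0 ∧ 2 ≤ ‖β‖ ^ (16 * K ^ 2) := by
  classical
  by_contra hcon
  push Not at hcon
  have hαq : IsIntegral ℚ α := hα.tower_top
  haveI : FiniteDimensional ℚ ℚ⟮α⟯ := adjoin.finiteDimensional hαq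
  let g : ℚ⟮α⟯ := AdjoinSimple.gen ℚ α
  have hg : algebraMap ℚ⟮α⟯ ℂ g = α := AdjoinSimple.algebraMap_gen ℚ α
  have hgi : IsIntegral ℤ g := by
    rw [← isIntegral_algebraMap_iff (algebraMap ℚ⟮α⟯ ℂ).injective, hg]; exact hα
  have hcard : Fintype.card (ℚ⟮α⟯ →ₐ[ℚ] ℂ) ≤ K := by
    rw [AlgHom.card, adjoin.finrank hαq, minpoly.isIntegrallyClosed_eq_field_fractions' ℚ hα,
      (minpoly.monic hα).natDegree_map]
    exact hK
  let i0 : ℚ⟮α⟯ →ₐ[ℚ] ℂ := IsScalarTower.toAlgHom ℚ ℚ⟮α⟯ ℂ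
  haveI : Nonempty (ℚ⟮α⟯ →ₐ[ℚ] ℂ) := ⟨i0⟩
  have hinj : ∀ σ : ℚ⟮α⟯ →ₐ[ℚ] ℂ, Function.Injective σ := fun σ => σ.toRingHom.injective
  have hmin : minpoly ℤ g = minpoly ℤ α := by
    have := minpoly.algHom_eq (i0.restrictScalars ℤ) (hinj i0) g
    rw [← this]
    congr 1
  have A1 : ∀ m : ℕ, ∃ s : ℤ, ∑ σ : ℚ⟮α⟯ →ₐ[ℚ] ℂ, (σ g) ^ m = s := by
    intro m
    have h1 := trace_eq_sum_embeddings (K := ℚ) (L := ℚ⟮α⟯) ℂ (x := g ^ m)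
    have h2 : IsIntegral ℤ (Algebra.trace ℚ ℚ⟮α⟯ (g ^ m)) := Algebra.isIntegral_trace (hgi.pow m)
    obtain ⟨s, hs⟩ := IsIntegrallyClosed.isIntegral_iff.mp h2
    refine ⟨s, ?_⟩
    simp only [map_pow] at h1 ⊢
    rw [← h1, ← hs]; simp
  have A2 : ∀ σ : ℚ⟮α⟯ →ₐ[ℚ] ℂ, σ g ≠ 0 := by
    intro σ h
    have : g = 0 := by
      apply hinj σ; rw [h, map_zero]
    rw [this, map_zero] at hg
    exact h0 hg.symm
  have A3 : ∀ σ : ℚ⟮α⟯ →ₐ[ℚ] ℂ, ‖σ g‖ ^ (16 * K ^ 2) < 2 := by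
    intro σ
    apply hcon
    rw [← hmin, ← AlgHom.restrictScalars_apply ℤ σ g, Polynomial.aeval_algHom_apply, minpoly.aeval, map_zero]
  obtain ⟨r, hr0, hr1⟩ := house_abs (fun σ : ℚ⟮α⟯ →ₐ[ℚ] ℂ => σ g) K
    (fun σ => hgi.map (σ.restrictScalars ℤ)) A1 A2 A3 hcard i0
  exact hr r hr0 hr1

open Filter

lemma totient_bound (d : ℕ) : (Odd d → d ≤ d.totient ^ 2) ∧ d ≤ 2 * d.totient ^ 2 := by
  induction d using Nat.recOnPosPrimePosCoprime with
  | zero => simp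
  | one => simp
  | prime_pow p e hp he =>
    rw [Nat.totient_prime_pow hp he]
    obtain ⟨f, rfl⟩ : ∃ f, e = f + 1 := ⟨e - 1, by omega⟩
    simp only [Nat.add_sub_cancel]
    rcases hp.eq_two_or_odd' with rfl | hodd
    · constructor
      · intro h
        exfalso
        have : Even (2 ^ (f + 1)) := by rw [pow_succ]; exact even_two.mul_left _
        exact (Nat.not_even_iff_odd.mpr h) this
      · have : 1 ≤ 2 ^ f := Nat.one_le_two_pow
        rw [pow_succ]; nlinarith
    · have h3 : 3 ≤ p := by
        have := hp.two_le
        rcases hodd with ⟨c, hc⟩; omega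
      have h1 : 1 ≤ p ^ f := Nat.one_le_pow _ _ hp.pos
      obtain ⟨q, rfl⟩ : ∃ q, p = q + 1 := ⟨p - 1, by omega⟩
      simp only [Nat.add_sub_cancel]
      have : (q + 1) ^ (f + 1) ≤ ((q + 1) ^ f * q) ^ 2 := by
        rw [pow_succ, mul_pow]
        apply Nat.mul_le_mul
        · nlinarith
        · nlinarith
      exact ⟨fun _ => this, by omega⟩
  | coprime a b ha hb hab iha ihb =>
    rw [Nat.totient_mul hab, mul_pow]
    constructor
    · intro h
      rw [Nat.odd_mul] at h
      exact Nat.mul_le_mul (iha.1 h.1) (ihb.1 h.2)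
    · rcases Nat.even_or_odd a with h | h
      · have hbo : Odd b := by
          rw [← Nat.not_even_iff_odd]; intro h'
          have := Nat.dvd_gcd h.two_dvd h'.two_dvd
          rw [hab] at this; omega
        calc a * b ≤ (2 * a.totient ^ 2) * b.totient ^ 2 := Nat.mul_le_mul iha.2 (ihb.1 hbo)
          _ = _ := by ring
      · calc a * b ≤ (a.totient ^ 2) * (2 * b.totient ^ 2) := Nat.mul_le_mul (iha.1 h) ihb.2
          _ = _ := by ring

open Polynomial in
lemma root_lt_two (q : ℂ[X]) (hq : q ≠ 0) (hc : ∀ i, ‖q.coeff i‖ ≤ ‖q.leadingCoeff‖) (w : ℂ)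
    (hw : q.eval w = 0) : ‖w‖ < 2 := by
  have h1 := Polynomial.IsRoot.norm_lt_cauchyBound hq (a := w) hw
  have h2 : q.cauchyBound ≤ 2 := by
    unfold Polynomial.cauchyBound
    have h3 : ((Finset.range q.natDegree).sup fun x => ‖q.coeff x‖₊) ≤ ‖q.leadingCoeff‖₊ :=
      Finset.sup_le fun i _ => hc i
    have h4 : ‖q.leadingCoeff‖₊ ≠ 0 := by simpa using hq
    have h5 : ((Finset.range q.natDegree).sup fun x => ‖q.coeff x‖₊) / ‖q.leadingCoeff‖₊ ≤ 1 :=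
      div_le_one_of_le₀ h3 (by positivity)
    calc _ ≤ (1 : NNReal) + 1 := by gcongr
      _ = 2 := by norm_num
  have := lt_of_lt_of_le h1 h2
  exact_mod_cast this

/-- integer polynomial attached to a coefficient vector -/
noncomputable def PZ {N : ℕ} (a : Fin N → ℤ) : Polynomial ℤ :=
  ∑ j : Fin N, Polynomial.C (a j) * Polynomial.X ^ (j : ℕ)

open Polynomial

lemma PZ_coeff {N : ℕ} (a : Fin N → ℤ) (i : Fin N) : (PZ a).coeff i = a i := by
  classical
  unfold PZ
  rw [finset_sum_coeff, Finset.sum_eq_single i]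
  · simp
  · intro j _ hj
    rw [coeff_C_mul, coeff_X_pow, if_neg, mul_zero]
    intro h; exact hj (Fin.ext h.symm)
  · simp

lemma PZ_coeff_ge {N : ℕ} (a : Fin N → ℤ) (i : ℕ) (hi : N ≤ i) : (PZ a).coeff i = 0 := by
  classical
  unfold PZ
  rw [finset_sum_coeff]
  apply Finset.sum_eq_zero
  intro j _
  rw [coeff_C_mul, coeff_X_pow, if_neg, mul_zero]
  have := j.2; omega

lemma PZ_aeval {N : ℕ} (a : Fin N → ℤ) (z : ℂ) :
    aeval z (PZ a) = ∑ j : Fin N, (a j : ℂ) * z ^ (j : ℕ) := by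
  simp [PZ]

lemma PZ_aeval_der {N : ℕ} (a : Fin N → ℤ) (z : ℂ) :
    z * aeval z (derivative (PZ a)) = ∑ j : Fin N, ((j : ℕ) : ℂ) * (a j : ℂ) * z ^ (j : ℕ) := by
  simp only [PZ, derivative_sum, derivative_C_mul_X_pow, map_sum, Finset.mul_sum]
  apply Finset.sum_congr rfl
  intro j _
  rcases Nat.eq_zero_or_pos (j : ℕ) with h | h
  · simp [h]
  · obtain ⟨t, ht⟩ : ∃ t, (j : ℕ) = t + 1 := ⟨j - 1, by omega⟩
    simp [ht, pow_succ]; ring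

lemma PZ_degree {N : ℕ} (hN : 0 < N) (a : Fin N → ℤ) (ha : a ∈ Sg (Fin N)) :
    (PZ a).natDegree = N - 1 ∧ (PZ a).leadingCoeff = a ⟨N - 1, by omega⟩ := by
  have h1 : (PZ a).coeff (N - 1) = a ⟨N - 1, by omega⟩ := PZ_coeff a ⟨N - 1, by omega⟩
  have h2 : (PZ a).natDegree = N - 1 := by
    apply le_antisymm
    · rw [natDegree_le_iff_coeff_eq_zero]
      intro i hi; exact PZ_coeff_ge a i (by omega)
    · apply le_natDegree_of_ne_zero
      rw [h1]
      rcases (mem_Sg a).mp ha ⟨N - 1, by omega⟩ with h | h <;> rw [h] <;> norm_num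
  exact ⟨h2, by rw [leadingCoeff, h2, h1]⟩

lemma PZ_ne {N : ℕ} (hN : 0 < N) (a : Fin N → ℤ) (ha : a ∈ Sg (Fin N)) : PZ a ≠ 0 := by
  rw [← leadingCoeff_ne_zero, (PZ_degree hN a ha).2]
  rcases (mem_Sg a).mp ha ⟨N - 1, by omega⟩ with h | h <;> rw [h] <;> norm_num

lemma PZ_root_lt {N : ℕ} (hN : 0 < N) (a : Fin N → ℤ) (ha : a ∈ Sg (Fin N)) (z : ℂ)
    (hz : aeval z (PZ a) = 0) : ‖z‖ < 2 := by
  have hinj : Function.Injective (Int.castRingHom ℂ) := by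
    intro x y h; simpa using h
  apply root_lt_two ((PZ a).map (Int.castRingHom ℂ))
  · rw [Polynomial.map_ne_zero_iff hinj]; exact PZ_ne hN a ha
  · intro i
    rw [leadingCoeff_map_of_injective hinj, (PZ_degree hN a ha).2, coeff_map]
    have e1 : ‖(Int.castRingHom ℂ) (a ⟨N - 1, by omega⟩)‖ = 1 := by
      rcases (mem_Sg a).mp ha ⟨N - 1, by omega⟩ with h | h <;> rw [h] <;> norm_num
    rw [e1]
    by_cases hi : i < N
    · have : (PZ a).coeff i = a ⟨i, hi⟩ := PZ_coeff a ⟨i, hi⟩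
      rw [this]
      rcases (mem_Sg a).mp ha ⟨i, hi⟩ with h | h <;> rw [h] <;> norm_num
    · rw [PZ_coeff_ge a i (by omega)]; simp
  · rw [← hz, eval_map]; rfl

lemma PZ_integral {N : ℕ} (hN : 0 < N) (a : Fin N → ℤ) (ha : a ∈ Sg (Fin N)) (z : ℂ)
    (hz : aeval z (PZ a) = 0) : IsIntegral ℤ z := by
  refine ⟨C (a ⟨N - 1, by omega⟩) * PZ a, ?_, ?_⟩
  · rw [Monic, leadingCoeff_mul, leadingCoeff_C, (PZ_degree hN a ha).2]
    rcases (mem_Sg a).mp ha ⟨N - 1, by omega⟩ with h | h <;> rw [h] <;> norm_num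
  · rw [eval₂_mul]
    have : eval₂ (algebraMap ℤ ℂ) z (PZ a) = 0 := hz
    rw [this, mul_zero]

lemma PZ_root_ne {N : ℕ} (hN : 0 < N) (a : Fin N → ℤ) (ha : a ∈ Sg (Fin N)) (z : ℂ)
    (hz : aeval z (PZ a) = 0) : z ≠ 0 := by
  rintro rfl
  rw [aeval_def, eval₂_at_zero] at hz
  have : (PZ a).coeff 0 = a ⟨0, hN⟩ := PZ_coeff a ⟨0, hN⟩
  rw [this] at hz
  rcases (mem_Sg a).mp ha ⟨0, hN⟩ with h | h <;> rw [h] at hz <;> norm_num at hz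

lemma minpoly_sq_dvd (P : ℤ[X]) (z : ℂ) (hi : IsIntegral ℤ z) (h1 : aeval z P = 0)
    (h2 : aeval z (derivative P) = 0) : (minpoly ℤ z) ^ 2 ∣ P := by
  obtain ⟨Q, hQ⟩ := minpoly.isIntegrallyClosed_dvd hi h1
  have h3 : aeval z (derivative (minpoly ℤ z)) ≠ 0 := by
    have hq : IsIntegral ℚ z := hi.tower_top
    have := (minpoly.irreducible hq).separable.aeval_derivative_ne_zero (minpoly.aeval ℚ z)
    rw [minpoly.isIntegrallyClosed_eq_field_fractions' ℚ hi, derivative_map, aeval_map_algebraMap] at this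
    exact this
  rw [hQ, derivative_mul, map_add, map_mul, map_mul, minpoly.aeval, zero_mul, add_zero] at h2
  have h4 : aeval z Q = 0 := (mul_eq_zero.mp h2).resolve_left h3
  obtain ⟨R, hR⟩ := minpoly.isIntegrallyClosed_dvd hi h4
  exact ⟨R, by rw [hQ, hR]; ring⟩

lemma minpoly_coeff_bd {N : ℕ} (hN : 0 < N) (a : Fin N → ℤ) (ha : a ∈ Sg (Fin N)) (z : ℂ)
    (hz : aeval z (PZ a) = 0) (K : ℕ) (hK : (minpoly ℤ z).natDegree ≤ K) (i : ℕ) :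
    |(minpoly ℤ z).coeff i| ≤ 4 ^ K := by
  have hi := PZ_integral hN a ha z hz
  have hd := minpoly.isIntegrallyClosed_dvd hi hz
  have h := coeff_bdd_of_roots_le (B := 2) (d := K) (Int.castRingHom ℂ) (minpoly.monic hi)
    (IsAlgClosed.splits _) hK ?_ i
  · rw [coeff_map] at h
    have e : ‖(Int.castRingHom ℂ) ((minpoly ℤ z).coeff i)‖ = ((|(minpoly ℤ z).coeff i| : ℤ) : ℝ) := by
      rw [eq_intCast, Complex.norm_intCast]; push_cast; rfl
    rw [e] at h
    have h2 : (K.choose (K / 2) : ℝ) ≤ 2 ^ K := by exact_mod_cast Nat.choose_le_two_pow K (K / 2)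
    have h3 : ((|(minpoly ℤ z).coeff i| : ℤ) : ℝ) ≤ ((4 ^ K : ℤ) : ℝ) := by
      refine h.trans ?_
      rw [max_eq_left (by norm_num)]
      push_cast
      calc (2:ℝ) ^ K * (K.choose (K / 2)) ≤ 2 ^ K * 2 ^ K := by gcongr
        _ = 4 ^ K := by rw [← mul_pow]; norm_num
    exact_mod_cast h3
  · intro w hw
    have hw2 := (mem_roots'.mp hw).2
    refine (PZ_root_lt hN a ha w ?_).le
    obtain ⟨Q, hQ⟩ := hd
    rw [hQ, map_mul]
    have : aeval w (minpoly ℤ z) = 0 := by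
      rw [IsRoot, eval_map] at hw2; exact hw2
    rw [this, zero_mul]

open Filter
open Polynomial

lemma card_mult (N L : ℕ) (hL : 0 < L) :
    N / L ≤ (Finset.univ.filter fun j : Fin N => L ∣ (j : ℕ)).card := by
  classical
  have hlt : ∀ i : Fin (N / L), (i : ℕ) * L < N := by
    intro i
    have h1 : (i : ℕ) + 1 ≤ N / L := i.2
    have h2 : ((i : ℕ) + 1) * L ≤ N := (Nat.mul_le_mul_right L h1).trans (Nat.div_mul_le_self N L)
    nlinarith
  have : (Finset.univ.image fun i : Fin (N / L) => (⟨(i : ℕ) * L, hlt i⟩ : Fin N)).card = N / L := by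
    rw [Finset.card_image_of_injective]
    · simp
    · intro i j h
      have : (i : ℕ) * L = (j : ℕ) * L := by simpa using h
      exact Fin.ext (Nat.eq_of_mul_eq_mul_right hL this)
  conv_lhs => rw [← this]
  apply Finset.card_le_card
  intro x hx
  obtain ⟨i, _, rfl⟩ := Finset.mem_image.mp hx
  simp

lemma nc_count {N : ℕ} (f : ℤ[X]) (β : ℂ) (hβ : aeval β f = 0) (L : ℕ) (hL : 0 < L)
    (hβ2 : 2 ≤ ‖β‖ ^ L) (A : Finset (Fin N → ℤ)) (hA : A ⊆ Sg (Fin N))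
    (hf : ∀ a ∈ A, f ∣ PZ a) : A.card ≤ 2 ^ (N - N / L) := by
  classical
  refine (card_le_of_inj A hA (Finset.univ.filter fun j : Fin N => L ∣ (j : ℕ)) ?_).trans ?_
  · intro a ha b hb hab
    set D := PZ a - PZ b with hD
    have hroot : ∀ c ∈ A, aeval β (PZ c) = 0 := by
      intro c hc
      obtain ⟨Q, hQ⟩ := hf c hc
      rw [hQ, map_mul, hβ, zero_mul]
    have hDr : aeval β D = 0 := by
      rw [hD, map_sub, hroot a ha, hroot b hb, sub_zero]
    have hDc : ∀ i, ¬ L ∣ i → D.coeff i = 0 := by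
      intro i hi
      rw [hD, coeff_sub]
      by_cases h : i < N
      · have h1 := PZ_coeff a ⟨i, h⟩
        have h2 := PZ_coeff b ⟨i, h⟩
        have h3 := hab ⟨i, h⟩ (by simpa using hi)
        simp only at h1 h2
        rw [h1, h2, h3, sub_self]
      · rw [PZ_coeff_ge a i (by omega), PZ_coeff_ge b i (by omega), sub_self]
    have hDv : ∀ i, D.coeff i = 0 ∨ |D.coeff i| = 2 := by
      intro i
      rw [hD, coeff_sub]
      by_cases h : i < N
      · have h1 := PZ_coeff a ⟨i, h⟩
        have h2 := PZ_coeff b ⟨i, h⟩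
        simp only at h1 h2
        rw [h1, h2]
        rcases (mem_Sg a).mp (hA ha) ⟨i, h⟩ with e | e <;>
        rcases (mem_Sg b).mp (hA hb) ⟨i, h⟩ with e' | e' <;> rw [e, e'] <;> norm_num
      · left; rw [PZ_coeff_ge a i (by omega), PZ_coeff_ge b i (by omega), sub_self]
    have hexp : expand ℤ L (contract L D) = D := by
      ext i
      rw [coeff_expand hL]
      split_ifs with h
      · rw [coeff_contract hL.ne', Nat.div_mul_cancel h]
      · exact (hDc i h).symm
    have hq0 : contract L D = 0 := by
      by_contra hne
      have hinj : Function.Injective (Int.castRingHom ℂ) := by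
        intro x y h; simpa using h
      have := root_lt_two ((contract L D).map (Int.castRingHom ℂ))
        ((Polynomial.map_ne_zero_iff hinj).mpr hne) ?_ (β ^ L) ?_
      · rw [norm_pow] at this; linarith
      · have nv : ∀ x : ℤ, ‖(Int.castRingHom ℂ) x‖ = ((|x| : ℤ) : ℝ) := by
          intro x; rw [eq_intCast, Complex.norm_intCast]; push_cast; rfl
        intro i
        rw [leadingCoeff_map_of_injective hinj, coeff_map, nv, nv]
        have hl : |(contract L D).leadingCoeff| = 2 := by
          have h1 : (contract L D).leadingCoeff ≠ 0 := leadingCoeff_ne_zero.mpr hne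
          rw [leadingCoeff, coeff_contract hL.ne'] at h1 ⊢
          exact (hDv _).resolve_left h1
        rw [hl, coeff_contract hL.ne']
        rcases hDv (i * L) with h | h <;> rw [h] <;> norm_num
      · rw [eval_map]
        have := expand_aeval L (contract L D) β
        rw [hexp, hDr] at this
        exact this.symm
    have hD0 : D = 0 := by rw [← hexp, hq0, map_zero]
    funext j
    rw [← PZ_coeff a j, ← PZ_coeff b j, sub_eq_zero.mp hD0]
  · apply Nat.pow_le_pow_right (by norm_num)
    have := card_mult N L hL
    rw [Fintype.card_fin]; omega

instance fact3 : Fact (Nat.Prime 3) := ⟨Nat.prime_three⟩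

/-- reduction mod 3 -/
noncomputable def P3 {N : ℕ} (a : Fin N → ℤ) : (ZMod 3)[X] := (PZ a).map (Int.castRingHom (ZMod 3))

lemma m3_count1 {N : ℕ} (f : (ZMod 3)[X]) (hf : f.Monic) (k : ℕ) (hk : f.natDegree = k)
    (hkN : 2 * k ≤ N) (A : Finset (Fin N → ℤ)) (hA : A ⊆ Sg (Fin N))
    (h : ∀ a ∈ A, f ^ 2 ∣ P3 a) : A.card ≤ 2 ^ (N - 2 * k) := by
  classical
  refine (card_le_of_inj A hA (Finset.univ.filter fun j : Fin N => (j : ℕ) < 2 * k) ?_).trans ?_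
  · intro a ha b hb hab
    have h1 : f ^ 2 ∣ P3 a - P3 b := dvd_sub (h a ha) (h b hb)
    have h2 : P3 a - P3 b = 0 := by
      apply Polynomial.eq_zero_of_dvd_of_degree_lt h1
      rw [degree_eq_natDegree (hf.pow 2).ne_zero, hf.natDegree_pow, hk, degree_lt_iff_coeff_zero]
      intro i hi
      rw [P3, P3, coeff_sub, coeff_map, coeff_map]
      by_cases hiN : i < N
      · have e1 := PZ_coeff a ⟨i, hiN⟩
        have e2 := PZ_coeff b ⟨i, hiN⟩
        simp only at e1 e2
        have hi' : 2 * k ≤ i := by exact_mod_cast hi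
        rw [e1, e2, hab ⟨i, hiN⟩ (by simpa using hi'), sub_self]
      · rw [PZ_coeff_ge a i (by omega), PZ_coeff_ge b i (by omega), sub_self]
    funext j
    have h3 : (P3 a).coeff j = (P3 b).coeff j := by rw [sub_eq_zero.mp h2]
    rw [P3, P3, coeff_map, coeff_map, PZ_coeff, PZ_coeff] at h3
    rcases (mem_Sg a).mp (hA ha) j with e | e <;>
    rcases (mem_Sg b).mp (hA hb) j with e' | e' <;> rw [e, e'] at h3 ⊢ <;> revert h3 <;>
      simp <;> decide
  · apply Nat.pow_le_pow_right (by norm_num)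
    have : 2 * k ≤ (Finset.univ.filter fun j : Fin N => (j : ℕ) < 2 * k).card := by
      have e : (Finset.univ.image fun i : Fin (2 * k) => (⟨(i : ℕ), by omega⟩ : Fin N)).card = 2 * k := by
        rw [Finset.card_image_of_injective]
        · simp
        · intro i j h
          have : (i : ℕ) = (j : ℕ) := by simpa using h
          exact Fin.ext this
      conv_lhs => rw [← e]
      apply Finset.card_le_card
      intro x hx
      obtain ⟨i, _, rfl⟩ := Finset.mem_image.mp hx
      simp
    rw [Fintype.card_fin]; omega

lemma m3_count {N : ℕ} (k : ℕ) (hkN : 2 * k ≤ N) (A : Finset (Fin N → ℤ)) (hA : A ⊆ Sg (Fin N))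
    (h : ∀ a ∈ A, ∃ f : (ZMod 3)[X], f.Monic ∧ f.natDegree = k ∧ f ^ 2 ∣ P3 a) :
    A.card ≤ 3 ^ k * 2 ^ (N - 2 * k) := by
  classical
  let F : (Fin k → ZMod 3) → (ZMod 3)[X] := fun c =>
    X ^ k + ∑ i : Fin k, C (c i) * X ^ (i : ℕ)
  let B : (Fin k → ZMod 3) → Finset (Fin N → ℤ) := fun c =>
    A.filter fun a => (F c).Monic ∧ (F c).natDegree = k ∧ (F c) ^ 2 ∣ P3 a
  have hsub : A ⊆ Finset.univ.biUnion B := by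
    intro a ha
    obtain ⟨f, h1, h2, h3⟩ := h a ha
    have hf : F (fun i => f.coeff i) = f := by
      conv_rhs => rw [h1.as_sum]
      simp only [F]
      rw [h2, ← Fin.sum_univ_eq_sum_range (fun i => C (f.coeff i) * X ^ i) k]
    rw [Finset.mem_biUnion]
    refine ⟨fun i => f.coeff i, Finset.mem_univ _, ?_⟩
    simp only [B, Finset.mem_filter]
    rw [hf]; exact ⟨ha, h1, h2, h3⟩
  refine (Finset.card_le_card hsub).trans ((Finset.card_biUnion_le_card_mul _ _ (2 ^ (N - 2 * k)) ?_).trans ?_)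
  · intro c _
    rcases (B c).eq_empty_or_nonempty with he | ⟨a, ha⟩
    · rw [he]; simp
    · have ha' := (Finset.mem_filter.mp ha).2
      apply m3_count1 (F c) ha'.1 k ha'.2.1 hkN
      · exact (Finset.filter_subset _ _).trans hA
      · intro b hb; exact (Finset.mem_filter.mp hb).2.2.2
  · simp [ZMod.card]

open Filter
open Polynomial

section bad
open Classical

/-- sign vectors whose polynomial has a double root -/
noncomputable def DR (N : ℕ) : Finset (Fin N → ℤ) :=
  (Sg (Fin N)).filter fun a => ∃ z : ℂ, aeval z (PZ a) = 0 ∧ aeval z (derivative (PZ a)) = 0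

/-- double root at minus one -/
noncomputable def Dm (N : ℕ) : Finset (Fin N → ℤ) :=
  (Sg (Fin N)).filter fun a => ∑ j : Fin N, a j * (-1) ^ (j : ℕ) = 0 ∧
    ∑ j : Fin N, ((j : ℕ) : ℤ) * a j * (-1) ^ (j : ℕ) = 0

noncomputable def B1 (N K : ℕ) : Finset (Fin N → ℤ) :=
  (Sg (Fin N)).filter fun a => ∃ k, K ≤ k ∧ 2 * k ≤ N ∧
    ∃ f : (ZMod 3)[X], f.Monic ∧ f.natDegree = k ∧ f ^ 2 ∣ P3 a

noncomputable def B2 (N K : ℕ) : Finset (Fin N → ℤ) :=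
  (Sg (Fin N)).filter fun a => ∃ f : ℤ[X], f.natDegree ≤ K ∧ (∀ i, |f.coeff i| ≤ 4 ^ K) ∧
    f ∣ PZ a ∧ ∃ β : ℂ, aeval β f = 0 ∧ 2 ≤ ‖β‖ ^ (16 * K ^ 2)

noncomputable def B3 (N K : ℕ) : Finset (Fin N → ℤ) :=
  (Sg (Fin N)).filter fun a => ∃ d : ℕ, 1 < d ∧ d ≤ 2 * K ^ 2 ∧ ∃ z : ℂ, z ^ d = 1 ∧ z.im ≠ 0 ∧
    ∑ j : Fin N, (a j : ℂ) * z ^ (j : ℕ) = 0 ∧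
    ∑ j : Fin N, ((j : ℕ) : ℂ) * (a j : ℂ) * z ^ (j : ℕ) = 0

lemma DR_sub (N K : ℕ) (hN : 0 < N) :
    DR N ⊆ (St N 0 0 ∪ Dm N) ∪ (B1 N K ∪ (B2 N K ∪ B3 N K)) := by
  intro a ha
  obtain ⟨hS, z, h1, h2⟩ := Finset.mem_filter.mp ha
  have hi := PZ_integral hN a hS z h1
  have h0 := PZ_root_ne hN a hS z h1
  have hsq := minpoly_sq_dvd (PZ a) z hi h1 h2
  have hdeg : 2 * (minpoly ℤ z).natDegree ≤ N := by
    have := natDegree_le_of_dvd hsq (PZ_ne hN a hS)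
    rw [(minpoly.monic hi).natDegree_pow, (PZ_degree hN a hS).1] at this
    omega
  have s1 := PZ_aeval a z
  have s2 := PZ_aeval_der a z
  rw [h1] at s1
  rw [h2, mul_zero] at s2
  simp only [Finset.mem_union]
  by_cases hk : K ≤ (minpoly ℤ z).natDegree
  · right; left
    rw [B1, Finset.mem_filter]
    refine ⟨hS, _, hk, hdeg, (minpoly ℤ z).map (Int.castRingHom (ZMod 3)),
      (minpoly.monic hi).map _, (minpoly.monic hi).natDegree_map _, ?_⟩
    rw [P3, ← Polynomial.map_pow]
    exact Polynomial.map_dvd _ hsq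
  push Not at hk
  by_cases hru : ∃ r : ℕ, 0 < r ∧ z ^ r = 1
  · obtain ⟨r, hr0, hr⟩ := hru
    have hfin : IsOfFinOrder z := isOfFinOrder_iff_pow_eq_one.mpr ⟨r, hr0, hr⟩
    by_cases him : z.im = 0
    · left
      have hn : ‖z‖ = 1 := Complex.norm_eq_one_of_pow_eq_one hr hr0.ne'
      have hz : z = 1 ∨ z = -1 := by
        have e : z = (z.re : ℂ) := by
          apply Complex.ext <;> simp [him]
        rw [e, Complex.norm_real, Real.norm_eq_abs] at hn
        rcases eq_or_eq_neg_of_abs_eq hn with h | h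
        · left; rw [e, h]; simp
        · right; rw [e, h]; simp
      rcases hz with rfl | rfl
      · left
        rw [St, Finset.mem_filter]
        refine ⟨hS, ?_, ?_⟩
        · simp only [one_pow, mul_one] at s1; exact_mod_cast s1.symm
        · simp only [one_pow, mul_one] at s2; exact_mod_cast s2.symm
      · right
        rw [Dm, Finset.mem_filter]
        refine ⟨hS, ?_, ?_⟩
        · exact_mod_cast s1.symm
        · exact_mod_cast s2.symm
    · right; right; right
      have hd0 : 0 < orderOf z := hfin.orderOf_pos
      have hprim := IsPrimitiveRoot.orderOf z
      have ht := hprim.totient_le_degree_minpoly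
      rw [B3, Finset.mem_filter]
      refine ⟨hS, orderOf z, ?_, ?_, z, pow_orderOf_eq_one z, him, s1.symm, s2.symm⟩
      · by_contra hle
        have : orderOf z = 1 := by omega
        rw [orderOf_eq_one_iff] at this
        rw [this] at him; simp at him
      · refine (totient_bound (orderOf z)).2.trans ?_
        gcongr; omega
  · right; right; left
    push Not at hru
    obtain ⟨β, hβ1, hβ2⟩ := house z hi h0 hru K hk.le
    rw [B2, Finset.mem_filter]
    exact ⟨hS, minpoly ℤ z, hk.le, minpoly_coeff_bd hN a hS z h1 K hk.le,
      (dvd_pow_self _ (by norm_num)).trans hsq, β, hβ1, hβ2⟩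

lemma B1_card (N K : ℕ) : ((B1 N K).card : ℝ) ≤ (N + 1) * 2 ^ N * (3 / 4) ^ K := by
  let A : ℕ → Finset (Fin N → ℤ) := fun k => (Sg (Fin N)).filter fun a =>
    K ≤ k ∧ 2 * k ≤ N ∧ ∃ f : (ZMod 3)[X], f.Monic ∧ f.natDegree = k ∧ f ^ 2 ∣ P3 a
  have hsub : B1 N K ⊆ (Finset.range (N + 1)).biUnion A := by
    intro a ha
    obtain ⟨hS, k, h1, h2, h3⟩ := Finset.mem_filter.mp ha
    rw [Finset.mem_biUnion]
    exact ⟨k, Finset.mem_range.mpr (by omega), Finset.mem_filter.mpr ⟨hS, h1, h2, h3⟩⟩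
  have h1 : ((B1 N K).card : ℝ) ≤ ∑ k ∈ Finset.range (N + 1), ((A k).card : ℝ) := by
    exact_mod_cast (Finset.card_le_card hsub).trans Finset.card_biUnion_le
  refine h1.trans ((Finset.sum_le_card_nsmul _ _ (2 ^ N * (3 / 4) ^ K) ?_).trans ?_)
  · intro k _
    by_cases hk : K ≤ k ∧ 2 * k ≤ N
    · have := m3_count k hk.2 (A k) (Finset.filter_subset _ _)
        (fun a ha => (Finset.mem_filter.mp ha).2.2.2)
      have h2 : ((A k).card : ℝ) ≤ 3 ^ k * 2 ^ (N - 2 * k) := by exact_mod_cast this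
      refine h2.trans ?_
      obtain ⟨t, ht⟩ : ∃ t, N = 2 * k + t := ⟨N - 2 * k, by omega⟩
      have e : (3 : ℝ) ^ k * 2 ^ (N - 2 * k) = 2 ^ N * (3 / 4) ^ k := by
        rw [ht, Nat.add_sub_cancel_left, pow_add, pow_mul, div_pow]
        norm_num
        field_simp
      rw [e]
      have : (3 / 4 : ℝ) ^ k ≤ (3 / 4) ^ K :=
        pow_le_pow_of_le_one (by norm_num) (by norm_num) hk.1
      gcongr
    · have : A k = ∅ := by
        apply Finset.filter_eq_empty_iff.mpr
        intro a _ h; exact hk ⟨h.1, h.2.1⟩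
      rw [this]; simp; positivity
  · rw [Finset.card_range, nsmul_eq_mul]; push_cast; apply le_of_eq; ring

lemma B2_card (N K : ℕ) (hK : 0 < K) :
    (B2 N K).card ≤ (2 * 4 ^ K + 1) ^ (K + 1) * 2 ^ (N - N / (16 * K ^ 2)) := by
  let F : (Fin (K + 1) → ℤ) → ℤ[X] := fun c => ∑ i : Fin (K + 1), C (c i) * X ^ (i : ℕ)
  let T : Finset (Fin (K + 1) → ℤ) := Fintype.piFinset fun _ => Finset.Icc (-4 ^ K) (4 ^ K)
  let A : (Fin (K + 1) → ℤ) → Finset (Fin N → ℤ) := fun c => (Sg (Fin N)).filter fun a =>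
    F c ∣ PZ a ∧ ∃ β : ℂ, aeval β (F c) = 0 ∧ 2 ≤ ‖β‖ ^ (16 * K ^ 2)
  have hsub : B2 N K ⊆ T.biUnion A := by
    intro a ha
    obtain ⟨hS, f, h1, h2, h3, h4⟩ := Finset.mem_filter.mp ha
    have hf : F (fun i => f.coeff i) = f := by
      conv_rhs => rw [f.as_sum_range_C_mul_X_pow' (Nat.lt_succ_of_le h1)]
      simp only [F]
      rw [← Fin.sum_univ_eq_sum_range (fun i => C (f.coeff i) * X ^ i) (K + 1)]
    rw [Finset.mem_biUnion]
    refine ⟨fun i => f.coeff i, ?_, ?_⟩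
    · simp only [T, Fintype.mem_piFinset, Finset.mem_Icc]
      intro i; exact abs_le.mp (h2 i)
    · simp only [A, Finset.mem_filter]
      rw [hf]; exact ⟨hS, h3, h4⟩
  have hT : T.card = (2 * 4 ^ K + 1) ^ (K + 1) := by
    simp only [T, Fintype.card_piFinset, Int.card_Icc, Finset.prod_const, Finset.card_univ,
      Fintype.card_fin]
    congr 1
    have : ((4 : ℤ) ^ K + 1 - -4 ^ K) = ((2 * 4 ^ K + 1 : ℕ) : ℤ) := by push_cast; ring
    rw [this, Int.toNat_natCast]
  rw [← hT]
  refine (Finset.card_le_card hsub).trans (Finset.card_biUnion_le_card_mul _ _ _ ?_)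
  intro c _
  rcases (A c).eq_empty_or_nonempty with he | ⟨a, ha⟩
  · rw [he]; simp
  · obtain ⟨_, _, β, hb1, hb2⟩ := Finset.mem_filter.mp ha
    exact nc_count (F c) β hb1 _ (by positivity) hb2 (A c) (Finset.filter_subset _ _)
      (fun b hb => (Finset.mem_filter.mp hb).2.1)

lemma W_bound {C0 : ℝ} (hC0 : 0 < C0)
    (hC : ∀ m, 1 ≤ m → ∀ s t, ((St m s t).card : ℝ) ≤ C0 / m ^ 2 * 2 ^ m) (N d : ℕ) (hd : 1 < d)
    (hdN : d ≤ N) : ∃ W : ℕ, (∀ s t, (St (N / d) s t).card ≤ W) ∧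
    ((W * W * 2 ^ (N - 2 * (N / d)) : ℕ) : ℝ) ≤ 16 * C0 ^ 2 * d ^ 4 / N ^ 4 * 2 ^ N := by
  set m := N / d with hm
  have hm1 : 1 ≤ m := (Nat.one_le_div_iff (by omega)).mpr hdN
  have hmd : m * d ≤ N := Nat.div_mul_le_self N d
  have h2m : 2 * m ≤ N := by nlinarith
  have hNm : N ≤ 2 * d * m := by
    have := Nat.lt_div_mul_add (a := N) (b := d) (by omega)
    rw [← hm] at this
    nlinarith
  have hmR : (0 : ℝ) < m := by exact_mod_cast hm1
  have hNR : (0 : ℝ) < N := by exact_mod_cast (by omega : 0 < N)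
  refine ⟨⌊C0 / m ^ 2 * 2 ^ m⌋₊, fun s t => Nat.le_floor (hC m hm1 s t), ?_⟩
  have hW : ((⌊C0 / (m:ℝ) ^ 2 * 2 ^ m⌋₊ : ℕ) : ℝ) ≤ C0 / m ^ 2 * 2 ^ m := Nat.floor_le (by positivity)
  set W := ⌊C0 / (m:ℝ) ^ 2 * 2 ^ m⌋₊
  push_cast
  calc (W : ℝ) * W * 2 ^ (N - 2 * m) ≤ (C0 / m ^ 2 * 2 ^ m) * (C0 / m ^ 2 * 2 ^ m) * 2 ^ (N - 2 * m) := by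
        gcongr
    _ = C0 ^ 2 / m ^ 4 * 2 ^ N := by
        have : (2 : ℝ) ^ N = 2 ^ m * 2 ^ m * 2 ^ (N - 2 * m) := by
          rw [← pow_add, ← pow_add]; congr 1; omega
        rw [this]; field_simp
    _ ≤ 16 * C0 ^ 2 * d ^ 4 / N ^ 4 * 2 ^ N := by
        have h3 : (N : ℝ) ≤ 2 * d * m := by exact_mod_cast hNm
        have h4 : (N : ℝ) ^ 4 ≤ 16 * d ^ 4 * m ^ 4 := by
          calc (N : ℝ) ^ 4 ≤ (2 * d * m) ^ 4 := by gcongr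
            _ = _ := by ring
        apply mul_le_mul_of_nonneg_right _ (by positivity)
        rw [div_le_div_iff₀ (by positivity) (by positivity)]
        nlinarith [mul_le_mul_of_nonneg_left h4 (sq_nonneg C0)]

lemma B3_card {C0 : ℝ} (hC0 : 0 < C0)
    (hC : ∀ m, 1 ≤ m → ∀ s t, ((St m s t).card : ℝ) ≤ C0 / m ^ 2 * 2 ^ m) (N K : ℕ)
    (hK : 2 * K ^ 2 ≤ N) :
    ((B3 N K).card : ℝ) ≤ (2 * K ^ 2 + 1) * (2 * K ^ 2) *
      (16 * C0 ^ 2 * (2 * K ^ 2) ^ 4 / N ^ 4 * 2 ^ N) := by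
  let A : ℕ → ℂ → Finset (Fin N → ℤ) := fun d z => (Sg (Fin N)).filter fun a =>
    ∑ j : Fin N, (a j : ℂ) * z ^ (j : ℕ) = 0 ∧
    ∑ j : Fin N, ((j : ℕ) : ℂ) * (a j : ℂ) * z ^ (j : ℕ) = 0 ∧ (1 < d ∧ z ^ d = 1 ∧ z.im ≠ 0)
  let R : ℕ → Finset ℂ := fun d => (nthRoots d (1 : ℂ)).toFinset
  set V : ℝ := 16 * C0 ^ 2 * (2 * K ^ 2) ^ 4 / N ^ 4 * 2 ^ N with hV
  have hV0 : 0 ≤ V := by positivity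
  have hsub : B3 N K ⊆ (Finset.range (2 * K ^ 2 + 1)).biUnion fun d => (R d).biUnion (A d) := by
    intro a ha
    obtain ⟨hS, d, h1, h2, z, h3, h4, h5, h6⟩ := Finset.mem_filter.mp ha
    simp only [Finset.mem_biUnion]
    refine ⟨d, Finset.mem_range.mpr (by omega), z, ?_, ?_⟩
    · simp only [R, Multiset.mem_toFinset]
      rw [mem_nthRoots (by omega)]; exact h3
    · exact Finset.mem_filter.mpr ⟨hS, h5, h6, h1, h3, h4⟩
  have hR : ∀ d, (R d).card ≤ d := fun d =>
    (Multiset.toFinset_card_le _).trans (card_nthRoots d 1)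
  have hA : ∀ d ≤ 2 * K ^ 2, ∀ z, ((A d z).card : ℝ) ≤ V := by
    intro d hd z
    by_cases hh : 1 < d ∧ z ^ d = 1 ∧ z.im ≠ 0
    · obtain ⟨W, hW1, hW2⟩ := W_bound hC0 hC N d hh.1 (hd.trans hK)
      have := count_unity hh.1 (Nat.mul_div_le N d) hW1 z hh.2.1 hh.2.2 (A d z)
        (Finset.filter_subset _ _) (fun a ha => (Finset.mem_filter.mp ha).2.1)
        (fun a ha => (Finset.mem_filter.mp ha).2.2.1)
      have h3 : ((A d z).card : ℝ) ≤ ((W * W * 2 ^ (N - 2 * (N / d)) : ℕ) : ℝ) := by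
        exact_mod_cast this
      refine h3.trans (hW2.trans ?_)
      have : (d : ℝ) ≤ 2 * K ^ 2 := by exact_mod_cast hd
      rw [hV]; gcongr
    · have : A d z = ∅ := by
        apply Finset.filter_eq_empty_iff.mpr
        intro a _ h; exact hh h.2.2
      rw [this]; simpa using hV0
  have h1 : ((B3 N K).card : ℝ) ≤ ∑ d ∈ Finset.range (2 * K ^ 2 + 1), ∑ z ∈ R d, ((A d z).card : ℝ) := by
    have := (Finset.card_le_card hsub).trans Finset.card_biUnion_le
    refine (Nat.cast_le.mpr this).trans ?_
    push_cast
    apply Finset.sum_le_sum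
    intro d _
    exact_mod_cast Finset.card_biUnion_le
  refine h1.trans ((Finset.sum_le_card_nsmul _ _ ((2 * K ^ 2) * V) ?_).trans ?_)
  · intro d hd
    have hd' : d ≤ 2 * K ^ 2 := by have := Finset.mem_range.mp hd; omega
    refine (Finset.sum_le_card_nsmul _ _ V fun z _ => hA d hd' z).trans ?_
    rw [nsmul_eq_mul]
    have : ((R d).card : ℝ) ≤ 2 * K ^ 2 := by exact_mod_cast (hR d).trans hd'
    gcongr
  · rw [Finset.card_range, nsmul_eq_mul]; push_cast; apply le_of_eq; ring

lemma B4_card {C0 : ℝ} (hC0 : 0 < C0)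
    (hC : ∀ m, 1 ≤ m → ∀ s t, ((St m s t).card : ℝ) ≤ C0 / m ^ 2 * 2 ^ m) (N : ℕ) (hN : 2 ≤ N) :
    ((St N 0 0 ∩ Dm N).card : ℝ) ≤ 256 * C0 ^ 2 / N ^ 4 * 2 ^ N := by
  obtain ⟨W, hW1, hW2⟩ := W_bound hC0 hC N 2 (by norm_num) hN
  have := count_pm (Nat.mul_div_le N 2) hW1 (St N 0 0 ∩ Dm N)
    (Finset.inter_subset_left.trans (Finset.filter_subset _ _))
    (fun a ha => (Finset.mem_filter.mp (Finset.mem_inter.mp ha).1).2.1)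
    (fun a ha => (Finset.mem_filter.mp (Finset.mem_inter.mp ha).1).2.2)
    (fun a ha => (Finset.mem_filter.mp (Finset.mem_inter.mp ha).2).2.1)
    (fun a ha => (Finset.mem_filter.mp (Finset.mem_inter.mp ha).2).2.2)
  have h3 : ((St N 0 0 ∩ Dm N).card : ℝ) ≤ ((W * W * 2 ^ (N - 2 * (N / 2)) : ℕ) : ℝ) := by
    exact_mod_cast this
  refine h3.trans (hW2.trans (le_of_eq ?_))
  push_cast; ring

lemma neg_one_pow_sq (j : ℕ) : ((-1 : ℤ) ^ j) * (-1) ^ j = 1 := by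
  rw [← mul_pow]; norm_num

lemma Dm_card (N : ℕ) : (Dm N).card = (St N 0 0).card := by
  have hmem : ∀ a : Fin N → ℤ, a ∈ Sg (Fin N) → (fun j : Fin N => a j * (-1) ^ (j : ℕ)) ∈ Sg (Fin N) := by
    intro a ha
    rw [mem_Sg] at ha ⊢
    intro j
    rcases ha j with h | h <;> rcases neg_one_pow_eq_or ℤ (j : ℕ) with h' | h' <;> simp [h, h']
  refine Finset.card_bij' (fun a _ j => a j * (-1) ^ (j : ℕ)) (fun a _ j => a j * (-1) ^ (j : ℕ))
    ?_ ?_ ?_ ?_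
  · intro a ha
    obtain ⟨hS, h1, h2⟩ := Finset.mem_filter.mp ha
    rw [St, Finset.mem_filter]
    refine ⟨hmem a hS, h1, ?_⟩
    rw [← h2]; apply Finset.sum_congr rfl; intro j _; ring
  · intro a ha
    obtain ⟨hS, h1, h2⟩ := Finset.mem_filter.mp ha
    rw [Dm, Finset.mem_filter]
    refine ⟨hmem a hS, ?_, ?_⟩
    · rw [← h1]; apply Finset.sum_congr rfl; intro j _
      rw [mul_assoc, neg_one_pow_sq, mul_one]
    · rw [← h2]; apply Finset.sum_congr rfl; intro j _
      rw [mul_assoc, mul_assoc, neg_one_pow_sq, mul_one]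
  · intro a _; funext j; simp only [mul_assoc, neg_one_pow_sq, mul_one]
  · intro a _; funext j; simp only [mul_assoc, neg_one_pow_sq, mul_one]

lemma sub_DR (N : ℕ) : St N 0 0 ∪ Dm N ⊆ DR N := by
  intro a ha
  rcases Finset.mem_union.mp ha with h | h
  · obtain ⟨hS, h1, h2⟩ := Finset.mem_filter.mp h
    rw [DR, Finset.mem_filter]
    refine ⟨hS, 1, ?_, ?_⟩
    · rw [PZ_aeval]; simp only [one_pow, mul_one]; exact_mod_cast h1
    · have := PZ_aeval_der a 1
      simp only [one_pow, mul_one, one_mul] at this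
      rw [this]; exact_mod_cast h2
  · obtain ⟨hS, h1, h2⟩ := Finset.mem_filter.mp h
    rw [DR, Finset.mem_filter]
    refine ⟨hS, -1, ?_, ?_⟩
    · rw [PZ_aeval]; exact_mod_cast h1
    · have := PZ_aeval_der a (-1)
      have h3 : ∑ j : Fin N, ((j : ℕ) : ℂ) * (a j : ℂ) * (-1) ^ (j : ℕ) = 0 := by exact_mod_cast h2
      rw [h3] at this
      simpa using this

end bad

open Filter
open Polynomial

section asym
open Classical

noncomputable def KK (N : ℕ) : ℕ := ⌊(N : ℝ) ^ ((1 : ℝ) / 10)⌋₊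

lemma KK_le (N : ℕ) : KK N ^ 10 ≤ N := by
  have h : ((KK N : ℕ) : ℝ) ≤ (N : ℝ) ^ ((1 : ℝ) / 10) := Nat.floor_le (by positivity)
  have : ((KK N : ℕ) : ℝ) ^ 10 ≤ N := by
    calc ((KK N : ℕ) : ℝ) ^ 10 ≤ ((N : ℝ) ^ ((1 : ℝ) / 10)) ^ 10 := by gcongr
      _ = (N : ℝ) := by
        rw [← Real.rpow_natCast, ← Real.rpow_mul (by positivity)]; norm_num
  exact_mod_cast this

lemma KK_lt (N : ℕ) : N < (KK N + 1) ^ 10 := by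
  have h : (N : ℝ) ^ ((1 : ℝ) / 10) < (KK N : ℝ) + 1 := Nat.lt_floor_add_one _
  have : (N : ℝ) < ((KK N : ℝ) + 1) ^ 10 := by
    calc (N : ℝ) = ((N : ℝ) ^ ((1 : ℝ) / 10)) ^ 10 := by
          rw [← Real.rpow_natCast, ← Real.rpow_mul (by positivity)]; norm_num
      _ < _ := by gcongr
  exact_mod_cast this

lemma KK_tendsto : Tendsto KK atTop atTop :=
  tendsto_nat_floor_atTop.comp
    ((tendsto_rpow_atTop (by norm_num)).comp tendsto_natCast_atTop_atTop)

/-- error function -/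
noncomputable def EE (C0 : ℝ) (K : ℕ) : ℝ :=
  ((K : ℝ) + 1) ^ 30 * (3 / 4) ^ K + (1 / 2) ^ K + 1792 * C0 ^ 2 / K

lemma EE_tendsto (C0 : ℝ) : Tendsto (EE C0) atTop (nhds 0) := by
  have h1 : Tendsto (fun K : ℕ => ((K : ℝ) + 1) ^ 30 * (3 / 4) ^ K) atTop (nhds 0) := by
    have := tendsto_pow_const_mul_const_pow_of_lt_one 30 (r := (3 / 4 : ℝ)) (by norm_num) (by norm_num)
    have h2 := (this.comp (tendsto_add_atTop_nat 1)).const_mul (4 / 3 : ℝ)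
    rw [mul_zero] at h2
    refine h2.congr fun K => ?_
    simp only [Function.comp]
    push_cast
    rw [pow_succ]; ring
  have h2 : Tendsto (fun K : ℕ => (1 / 2 : ℝ) ^ K) atTop (nhds 0) :=
    tendsto_pow_atTop_nhds_zero_of_lt_one (by norm_num) (by norm_num)
  have h3 := tendsto_const_div_atTop_nhds_zero_nat (1792 * C0 ^ 2)
  have := (h1.add h2).add h3
  rw [add_zero, add_zero] at this
  exact this

lemma two_term (N K : ℕ) (hK : 4 ≤ K) (h1 : K ^ 10 ≤ N) (h2 : N < (K + 1) ^ 10) :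
    (N : ℝ) ^ 2 * ((2 * 4 ^ K + 1) ^ (K + 1) * 2 ^ (N - N / (16 * K ^ 2))) / 2 ^ N ≤ (1 / 2) ^ K := by
  have hK0 : 0 < K := by omega
  set M := N / (16 * K ^ 2) with hM
  have hMN : M ≤ N := Nat.div_le_self _ _
  have hM2 : K ^ 6 ≤ M := by
    rw [hM, Nat.le_div_iff_mul_le (by positivity)]
    calc K ^ 6 * (16 * K ^ 2) = 16 * K ^ 8 := by ring
      _ ≤ K ^ 2 * K ^ 8 := by gcongr; nlinarith
      _ = K ^ 10 := by ring
      _ ≤ N := h1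
  have hexp : 20 * (K + 1) + 2 * (K + 1) * (K + 1) + K ≤ M := by
    refine le_trans ?_ hM2
    have e : K ^ 6 = K ^ 2 * K ^ 4 := by ring
    have e4 : 4 ^ 4 ≤ K ^ 4 := Nat.pow_le_pow_left hK 4
    rw [e]; nlinarith
  have a1 : N ^ 2 ≤ 2 ^ (20 * (K + 1)) := by
    calc N ^ 2 ≤ ((K + 1) ^ 10) ^ 2 := by gcongr
      _ = (K + 1) ^ 20 := by ring
      _ ≤ (2 ^ (K + 1)) ^ 20 := by gcongr; exact Nat.lt_two_pow_self.le
      _ = _ := by rw [← pow_mul]; ring_nf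
  have a2 : (2 * 4 ^ K + 1) ^ (K + 1) ≤ 2 ^ (2 * (K + 1) * (K + 1)) := by
    rw [pow_mul]
    gcongr
    rw [pow_mul, pow_succ]
    have : 1 ≤ 4 ^ K := Nat.one_le_pow _ _ (by norm_num)
    norm_num; omega
  have main : N ^ 2 * ((2 * 4 ^ K + 1) ^ (K + 1) * 2 ^ (N - M)) * 2 ^ K ≤ 2 ^ N := by
    calc N ^ 2 * ((2 * 4 ^ K + 1) ^ (K + 1) * 2 ^ (N - M)) * 2 ^ K
        ≤ 2 ^ (20 * (K + 1)) * (2 ^ (2 * (K + 1) * (K + 1)) * 2 ^ (N - M)) * 2 ^ K := by gcongr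
      _ = 2 ^ (20 * (K + 1) + (2 * (K + 1) * (K + 1) + (N - M)) + K) := by
        rw [pow_add, pow_add, pow_add]
      _ ≤ 2 ^ N := Nat.pow_le_pow_right (by norm_num) (by omega)
  have main' : (N : ℝ) ^ 2 * ((2 * 4 ^ K + 1) ^ (K + 1) * 2 ^ (N - M)) * 2 ^ K ≤ 2 ^ N := by
    exact_mod_cast main
  rw [div_le_iff₀ (by positivity), div_pow, one_pow, div_mul_eq_mul_div, one_mul,
    le_div_iff₀ (by positivity)]
  exact main'

lemma abs_est (n p dr st b1 b2 b3 b4 e1 e2 c K : ℝ) (hn : 0 ≤ n) (hp : 0 < p)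
    (q1 : n * b1 / p ≤ e1) (q2 : n * b2 / p ≤ e2) (q3 : n * b3 / p ≤ 1536 * c / K)
    (q4 : n * b4 / p ≤ 256 * c / K) (u : dr ≤ 2 * st + (b1 + (b2 + b3))) (l : 2 * st ≤ dr + b4)
    (p1 : 0 ≤ e1) (p2 : 0 ≤ e2) (p3 : 0 ≤ c / K) :
    |n * dr / p - 2 * (n * st / p)| ≤ e1 + e2 + 1792 * c / K := by
  have hc0 : 0 ≤ n / p := by positivity
  have hcc : ∀ y : ℝ, n * y / p = (n / p) * y := fun y => by ring
  rw [hcc] at q1 q2 q3 q4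
  rw [hcc, hcc]
  generalize n / p = r at *
  have u := mul_le_mul_of_nonneg_left u hc0
  have l := mul_le_mul_of_nonneg_left l hc0
  have e : r * (2 * st + (b1 + (b2 + b3))) = 2 * (r * st) + (r * b1 + (r * b2 + r * b3)) := by ring
  have e' : r * (2 * st) = 2 * (r * st) := by ring
  have e3 : r * (dr + b4) = r * dr + r * b4 := by ring
  have p4 : 1792 * c / K = 1792 * (c / K) := by ring
  have p5 : 1536 * c / K = 1536 * (c / K) := by ring
  have p6 : 256 * c / K = 256 * (c / K) := by ring
  rw [p5] at q3
  rw [p6] at q4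
  rw [e] at u
  rw [e', e3] at l
  rw [p4, abs_le]
  constructor <;> linarith

lemma DR_est {C0 : ℝ} (hC0 : 0 < C0)
    (hC : ∀ m, 1 ≤ m → ∀ s t, ((St m s t).card : ℝ) ≤ C0 / m ^ 2 * 2 ^ m) (N K : ℕ) (hK : 4 ≤ K)
    (h1 : K ^ 10 ≤ N) (h2 : N < (K + 1) ^ 10) :
    |(N : ℝ) ^ 2 * (DR N).card / 2 ^ N - 2 * ((N : ℝ) ^ 2 * (St N 0 0).card / 2 ^ N)| ≤ EE C0 K := by
  have hKR : (4 : ℝ) ≤ K := by exact_mod_cast hK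
  have hKN : K ≤ N := le_trans (Nat.le_self_pow (by norm_num) K) h1
  have h2K : 2 * K ^ 2 ≤ N := by
    refine le_trans ?_ h1
    calc 2 * K ^ 2 ≤ K ^ 8 * K ^ 2 := by
          gcongr
          exact (by omega : 2 ≤ K).trans (Nat.le_self_pow (by norm_num) K)
      _ = K ^ 10 := by ring
  have hNR : (0 : ℝ) < N := by exact_mod_cast (by omega : 0 < N)
  have h1R : (K : ℝ) ^ 10 ≤ N := by exact_mod_cast h1
  have h2R : (N : ℝ) + 1 ≤ ((K : ℝ) + 1) ^ 10 := by exact_mod_cast h2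
  have hp : (0 : ℝ) < 2 ^ N := by positivity
  have q1 : (N : ℝ) ^ 2 * (B1 N K).card / 2 ^ N ≤ ((K : ℝ) + 1) ^ 30 * (3 / 4) ^ K := by
    rw [div_le_iff₀ hp]
    calc (N : ℝ) ^ 2 * (B1 N K).card ≤ ((N : ℝ) + 1) ^ 2 * ((N + 1) * 2 ^ N * (3 / 4) ^ K) := by
          gcongr
          · linarith
          · exact B1_card N K
      _ = ((N : ℝ) + 1) ^ 3 * (3 / 4) ^ K * 2 ^ N := by ring
      _ ≤ (((K : ℝ) + 1) ^ 10) ^ 3 * (3 / 4) ^ K * 2 ^ N := by gcongr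
      _ = _ := by ring
  have q2 : (N : ℝ) ^ 2 * (B2 N K).card / 2 ^ N ≤ (1 / 2) ^ K := by
    refine le_trans ?_ (two_term N K hK h1 h2)
    have : ((B2 N K).card : ℝ) ≤ (2 * 4 ^ K + 1) ^ (K + 1) * 2 ^ (N - N / (16 * K ^ 2)) := by
      exact_mod_cast B2_card N K (by omega)
    gcongr
  have hinv : (K : ℝ) ^ 12 / N ^ 2 ≤ 1 / K := by
    rw [div_le_div_iff₀ (by positivity) (by positivity)]
    calc (K : ℝ) ^ 12 * K = (K : ℝ) ^ 13 := by ring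
      _ ≤ (K : ℝ) ^ 20 := pow_le_pow_right₀ (by linarith) (by norm_num)
      _ = ((K : ℝ) ^ 10) ^ 2 := by ring
      _ ≤ (N : ℝ) ^ 2 := by gcongr
      _ = 1 * (N : ℝ) ^ 2 := by ring
  have q3 : (N : ℝ) ^ 2 * (B3 N K).card / 2 ^ N ≤ 1536 * C0 ^ 2 / K := by
    rw [div_le_iff₀ hp]
    have hb := B3_card hC0 hC N K h2K
    have h3 : (2 * (K : ℝ) ^ 2 + 1) ≤ 3 * K ^ 2 := by nlinarith
    calc (N : ℝ) ^ 2 * (B3 N K).card ≤ N ^ 2 * ((3 * K ^ 2) * (2 * K ^ 2) *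
      (16 * C0 ^ 2 * (2 * K ^ 2) ^ 4 / N ^ 4 * 2 ^ N)) := by
          gcongr
          refine hb.trans ?_
          gcongr
      _ = 1536 * C0 ^ 2 * (K ^ 12 / N ^ 2) * 2 ^ N := by field_simp; ring
      _ ≤ 1536 * C0 ^ 2 * (1 / K) * 2 ^ N := by gcongr
      _ = _ := by ring
  have q4 : (N : ℝ) ^ 2 * (St N 0 0 ∩ Dm N).card / 2 ^ N ≤ 256 * C0 ^ 2 / K := by
    rw [div_le_iff₀ hp]
    have hb := B4_card hC0 hC N (by omega)
    calc (N : ℝ) ^ 2 * (St N 0 0 ∩ Dm N).card ≤ N ^ 2 * (256 * C0 ^ 2 / N ^ 4 * 2 ^ N) := by gcongr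
      _ = 256 * C0 ^ 2 * (1 / N ^ 2) * 2 ^ N := by field_simp
      _ ≤ 256 * C0 ^ 2 * (K ^ 12 / N ^ 2) * 2 ^ N := by
          gcongr
          exact one_le_pow₀ (by linarith)
      _ ≤ 256 * C0 ^ 2 * (1 / K) * 2 ^ N := by gcongr
      _ = _ := by ring
  have hu : (St N 0 0 ∪ Dm N).card + (St N 0 0 ∩ Dm N).card = 2 * (St N 0 0).card := by
    rw [Finset.card_union_add_card_inter, Dm_card]; ring
  have hup : (DR N).card ≤ 2 * (St N 0 0).card + ((B1 N K).card + ((B2 N K).card + (B3 N K).card)) := by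
    have e := Finset.card_le_card (DR_sub N K (by omega))
    have e1 := Finset.card_union_le (St N 0 0 ∪ Dm N) (B1 N K ∪ (B2 N K ∪ B3 N K))
    have e2 := Finset.card_union_le (B1 N K) (B2 N K ∪ B3 N K)
    have e3 := Finset.card_union_le (B2 N K) (B3 N K)
    omega
  have hlo : 2 * (St N 0 0).card ≤ (DR N).card + (St N 0 0 ∩ Dm N).card := by
    have e := Finset.card_le_card (sub_DR N)
    omega
  have hupR : ((DR N).card : ℝ) ≤ 2 * (St N 0 0).card + ((B1 N K).card + ((B2 N K).card + (B3 N K).card)) := by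
    exact_mod_cast hup
  have hloR : 2 * ((St N 0 0).card : ℝ) ≤ (DR N).card + (St N 0 0 ∩ Dm N).card := by
    exact_mod_cast hlo
  have p3 : 0 ≤ C0 ^ 2 / K := by positivity
  exact abs_est _ _ _ _ _ _ _ _ _ _ _ _ (by positivity) hp q1 q2 q3 q4 hupR hloR (by positivity)
    (by positivity) (by positivity)

lemma DR_lim : Tendsto (fun N : ℕ => (N : ℝ) ^ 2 * (DR N).card / 2 ^ N)
    (atTop ⊓ Filter.principal {N : ℕ | 4 ∣ N}) (nhds (8 * Real.sqrt 3 / Real.pi)) := by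
  obtain ⟨C0, hC0, hC⟩ := St_bound
  have hE : Tendsto (fun N => EE C0 (KK N)) atTop (nhds 0) := (EE_tendsto C0).comp KK_tendsto
  have hdiff : Tendsto (fun N : ℕ => (N : ℝ) ^ 2 * (DR N).card / 2 ^ N -
      2 * ((N : ℝ) ^ 2 * (St N 0 0).card / 2 ^ N)) atTop (nhds 0) := by
    refine squeeze_zero_norm' ?_ hE
    filter_upwards [KK_tendsto.eventually_ge_atTop 4] with N hN
    exact DR_est hC0 hC N (KK N) hN (KK_le N) (KK_lt N)
  have := (hdiff.mono_left (inf_le_left (b := Filter.principal {N : ℕ | 4 ∣ N}))).add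
    (St_lim.const_mul 2)
  have e : 0 + 2 * (4 * Real.sqrt 3 / Real.pi) = 8 * Real.sqrt 3 / Real.pi := by ring
  rw [e] at this
  refine this.congr fun N => ?_
  ring

end asym

lemma polyOf_eval (n : ℕ) (a : Fin (n + 1) → ℤ) (z : ℂ) :
    (polyOf n a).eval z = aeval z (PZ a) ∧
    (derivative (polyOf n a)).eval z = aeval z (derivative (PZ a)) := by
  have h : polyOf n a = (PZ a).map (algebraMap ℤ ℂ) := by
    simp [polyOf, PZ, Polynomial.map_sum]
  rw [h, derivative_map]
  exact ⟨eval_map_algebraMap _ _, eval_map_algebraMap _ _⟩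

lemma count_eq (n : ℕ) : littlewoodDoubleRootCount n = (DR (n + 1)).card := by
  classical
  unfold littlewoodDoubleRootCount
  rw [← Nat.card_eq_finsetCard]
  apply Nat.card_congr
  apply Equiv.subtypeEquivRight
  intro a
  rw [DR, Finset.mem_filter, mem_Sg]
  unfold hasDoubleRoot
  simp only [(polyOf_eval n a _).1, (polyOf_eval n a _).2]

/-- Along `n` with `n + 1` divisible by `4`, the probability that a random Littlewood
polynomial of degree `n` has a double root is asymptotic to `8√3/(π n²)`. -/
theorem littlewood_double_root_div_four :
    Tendsto (fun n : ℕ => (n : ℝ) ^ 2 * (littlewoodDoubleRootCount n : ℝ) / 2 ^ (n + 1))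
      (atTop ⊓ Filter.principal {n : ℕ | 4 ∣ n + 1}) (nhds (8 * Real.sqrt 3 / Real.pi)) := by
  have hs : Tendsto (fun n : ℕ => n + 1) (atTop ⊓ Filter.principal {n : ℕ | 4 ∣ n + 1})
      (atTop ⊓ Filter.principal {N : ℕ | 4 ∣ N}) := by
    refine Filter.Tendsto.inf (tendsto_add_atTop_nat 1) ?_
    rw [tendsto_principal_principal]
    intro n hn; exact hn
  have h1 := DR_lim.comp hs
  have h2 : Tendsto (fun n : ℕ => ((n : ℝ) / ((n : ℝ) + 1)) ^ 2)
      (atTop ⊓ Filter.principal {n : ℕ | 4 ∣ n + 1}) (nhds (1 ^ 2)) :=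
    ((tendsto_natCast_div_add_atTop (1 : ℝ)).mono_left inf_le_left).pow 2
  have h3 := h2.mul h1
  rw [one_pow, one_mul] at h3
  refine h3.congr fun n => ?_
  simp only [Function.comp]
  rw [count_eq]
  push_cast
  have : (n : ℝ) + 1 ≠ 0 := by positivity
  field_simp
end

section
/- Assume condition (C). Then lim_{n→∞} P(P_n has a double root in ℂ) = μ({0})². -/
open Filter MeasureTheory

lemma pi_inj_bound {ι : Type*} [Fintype ι] (μ : Measure ℤ) [IsProbabilityMeasure μ]
    (p : ENNReal) (hp : ∀ x, μ {x} ≤ p) (T : ι → Prop) [DecidablePred T] (S : Set (ι → ℤ))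
    (hS : ∀ a ∈ S, ∀ b ∈ S, (∀ j, ¬ T j → a j = b j) → a = b) :
    Measure.pi (fun _ : ι => μ) S ≤ p ^ (Fintype.card {j // T j}) := by
  classical
  have h1 : Measure.pi (fun _ : ι => μ) S = ∑' a : S, ∏ j, μ {(a : ι → ℤ) j} := by
    rw [← Measure.tsum_indicator_apply_singleton _ S (Set.to_countable S).measurableSet, ← tsum_subtype]
    simp
  rw [h1]
  have h2 : ∀ a : S, ∏ j, μ {(a : ι → ℤ) j} ≤ p ^ (Fintype.card {j // T j}) *
      Measure.pi (fun _ : {j // ¬ T j} => μ) {fun j : {j // ¬ T j} => (a : ι → ℤ) j} := by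
    intro a
    rw [Measure.pi_singleton, ← Fintype.prod_subtype_mul_prod_subtype T]
    gcongr
    calc _ ≤ ∏ i : {j // T j}, p := Finset.prod_le_prod' (fun i _ => hp _)
      _ = _ := by simp
  refine (ENNReal.tsum_le_tsum h2).trans ?_
  rw [ENNReal.tsum_mul_left]
  have hinj : Function.Injective (fun a : S => (fun j : {j // ¬ T j} => (a : ι → ℤ) j)) := by
    intro a b h
    apply Subtype.ext
    apply hS a a.2 b b.2
    intro j hj
    exact congrFun h ⟨j, hj⟩
  have h3 := ENNReal.tsum_comp_le_tsum_of_injective hinj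
    (fun x => Measure.pi (fun _ : {j // ¬ T j} => μ) {x})
  have h4 : ∑' x, Measure.pi (fun _ : {j // ¬ T j} => μ) {x} = 1 := by
    have := Measure.tsum_indicator_apply_singleton (Measure.pi (fun _ : {j // ¬ T j} => μ)) Set.univ MeasurableSet.univ
    simpa using this
  rw [h4] at h3
  calc _ ≤ p ^ (Fintype.card {j // T j}) * 1 := by gcongr
    _ = _ := mul_one _

lemma anticonc {ι : Type*} [Fintype ι] [DecidableEq ι] (μ : Measure ℤ) [IsProbabilityMeasure μ]
    (c : ENNReal) (g : ℤ → ℤ)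
    (hg : ∀ x ∈ ({-1, 0, 1} : Set ℤ), g x ≠ x ∧ g x ∈ ({-1, 0, 1} : Set ℤ) ∧ c ≤ μ {g x})
    (J : Finset ι) (b : ι → ℂ) (hb0 : ∀ j ∈ J, b j ≠ 0)
    (hbi : ∀ i ∈ J, ∀ j ∈ J, ‖b i‖ = ‖b j‖ → i = j) :
    (J.card : ENNReal) * c * Measure.pi (fun _ : ι => μ)
      {a | (∀ j, a j ∈ ({-1, 0, 1} : Set ℤ)) ∧ ∑ j, (a j : ℂ) * b j = 0} ≤ 2 := by
  set S := {a : ι → ℤ | (∀ j, a j ∈ ({-1, 0, 1} : Set ℤ)) ∧ ∑ j, (a j : ℂ) * b j = 0} with hSdef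
  set ν := Measure.pi (fun _ : ι => μ) with hν
  have h1 : ν S = ∑' a : S, ν {(a : ι → ℤ)} := by
    rw [← Measure.tsum_indicator_apply_singleton _ S (Set.to_countable S).measurableSet, ← tsum_subtype]
  have hupd : ∀ (a : S) (j : ι), c * ν {(a : ι → ℤ)} ≤
      ν {Function.update (a : ι → ℤ) j (g ((a : ι → ℤ) j))} := by
    intro a j
    rw [hν, Measure.pi_singleton, Measure.pi_singleton,
      ← Finset.mul_prod_erase _ _ (Finset.mem_univ j), ← Finset.mul_prod_erase _ _ (Finset.mem_univ j)]
    have e : ∏ x ∈ Finset.univ.erase j, μ {Function.update (a : ι → ℤ) j (g ((a : ι → ℤ) j)) x}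
        = ∏ x ∈ Finset.univ.erase j, μ {(a : ι → ℤ) x} := by
      apply Finset.prod_congr rfl
      intro x hx
      rw [Function.update_of_ne (Finset.ne_of_mem_erase hx)]
    rw [e, ← mul_assoc]
    gcongr
    rw [Function.update_self]
    calc c * μ {(a : ι → ℤ) j} ≤ c * 1 := by gcongr; exact prob_le_one
      _ ≤ _ := by rw [mul_one]; exact (hg _ (a.2.1 j)).2.2
  let F : J × S → (ι → ℤ) × Bool := fun x =>
    (Function.update (x.2 : ι → ℤ) x.1 (g ((x.2 : ι → ℤ) x.1)),
      decide (|g ((x.2 : ι → ℤ) x.1) - (x.2 : ι → ℤ) x.1| = 2))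
  have hsum : ∀ (a : S) (j : ι), ∑ i, ((Function.update (a : ι → ℤ) j (g ((a : ι → ℤ) j)) i : ℤ) : ℂ) * b i
      = ((g ((a : ι → ℤ) j) - (a : ι → ℤ) j : ℤ) : ℂ) * b j := by
    intro a j
    have := a.2.2
    rw [← Finset.add_sum_erase _ _ (Finset.mem_univ j)] at this ⊢
    have e : ∑ x ∈ Finset.univ.erase j, ((Function.update (a : ι → ℤ) j (g ((a : ι → ℤ) j)) x : ℤ) : ℂ) * b x
        = ∑ x ∈ Finset.univ.erase j, ((a : ι → ℤ) x : ℂ) * b x := by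
      apply Finset.sum_congr rfl
      intro x hx
      rw [Function.update_of_ne (Finset.ne_of_mem_erase hx)]
    rw [e, Function.update_self]
    push_cast
    linear_combination this
  have hFinj : Function.Injective F := by
    rintro ⟨i, a⟩ ⟨j, a'⟩ h
    simp only [F, Prod.mk.injEq, decide_eq_decide] at h
    obtain ⟨h1, h2⟩ := h
    have e1 := hsum a i
    rw [h1, hsum a' j] at e1
    have habs : ∀ (a : S) (j : ι), |g ((a : ι → ℤ) j) - (a : ι → ℤ) j| = 1 ∨
        |g ((a : ι → ℤ) j) - (a : ι → ℤ) j| = 2 := by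
      intro a j
      have h0 := a.2.1 j
      obtain ⟨q1, q2, -⟩ := hg _ h0
      simp only [Set.mem_insert_iff, Set.mem_singleton_iff] at h0 q2
      grind
    have habs' : |g ((a : ι → ℤ) i) - (a : ι → ℤ) i| = |g ((a' : ι → ℤ) j) - (a' : ι → ℤ) j| := by
      have := habs a i
      have := habs a' j
      grind
    have hij : (i : ι) = j := by
      apply hbi i i.2 j j.2
      have e2 := congrArg norm e1
      rw [norm_mul, norm_mul, Complex.norm_intCast, Complex.norm_intCast, ← Int.cast_abs, ← Int.cast_abs, habs'] at e2
      have : ((|g ((a' : ι → ℤ) j) - (a' : ι → ℤ) j| : ℤ) : ℝ) ≠ 0 := by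
        have := habs a' j
        norm_cast
        omega
      exact (mul_left_cancel₀ this e2).symm
    have hij' : i = j := Subtype.ext hij
    subst hij'
    have hagree : ∀ x, x ≠ (i : ι) → (a : ι → ℤ) x = (a' : ι → ℤ) x := by
      intro x hx
      have := congrFun h1 x
      rwa [Function.update_of_ne hx, Function.update_of_ne hx] at this
    have hgi : g ((a : ι → ℤ) i) = g ((a' : ι → ℤ) i) := by
      have := congrFun h1 i
      rwa [Function.update_self, Function.update_self] at this
    have hai : (a : ι → ℤ) i = (a' : ι → ℤ) i := by
      have e3 := mul_right_cancel₀ (hb0 i i.2) e1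
      have : g ((a' : ι → ℤ) i) - (a' : ι → ℤ) i = g ((a : ι → ℤ) i) - (a : ι → ℤ) i := by exact_mod_cast e3
      omega
    have : a = a' := by
      apply Subtype.ext
      funext x
      by_cases hx : x = i
      · rw [hx, hai]
      · exact hagree x hx
    rw [this]
  have h3 := ENNReal.tsum_comp_le_tsum_of_injective hFinj (fun y => ν {y.1})
  have h4 : ∑' x, ν {x} = 1 := by
    have := Measure.tsum_indicator_apply_singleton ν Set.univ MeasurableSet.univ
    simpa [hν] using this
  have h5 : ∑' y : (ι → ℤ) × Bool, ν {y.1} = 2 := by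
    rw [ENNReal.tsum_prod']
    simp only [tsum_fintype, Fintype.sum_bool]
    rw [ENNReal.tsum_add, h4]
    norm_num
  rw [h5] at h3
  refine le_trans ?_ h3
  rw [ENNReal.tsum_prod', tsum_fintype]
  calc (J.card : ENNReal) * c * ν S = ∑ i : J, c * ν S := by simp [mul_assoc]
    _ ≤ _ := by
      apply Finset.sum_le_sum
      intro i _
      rw [h1, ← ENNReal.tsum_mul_left]
      exact ENNReal.tsum_le_tsum (fun a => hupd a i)

def smallPoly (P : Polynomial ℤ) : Prop := ∀ i, P.coeff i = -1 ∨ P.coeff i = 0 ∨ P.coeff i = 1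

lemma cnorm_prod (s : Multiset ℂ) (φ : ℂ → ℂ) :
    ‖(s.map φ).prod‖ = (s.map (fun β => ‖φ β‖)).prod := by
  induction s using Multiset.induction_on with
  | empty => simp
  | cons a s ih => simp [ih]

lemma small_root_lt (P : Polynomial ℤ) (hP : smallPoly P) (h0 : P ≠ 0) (β : ℂ)
    (hβ : Polynomial.aeval β P = 0) : ‖β‖ < 2 := by
  have hn : ∀ i, ‖(P.map (Int.castRingHom ℂ)).coeff i‖₊ ≤ 1 := by
    intro i
    rw [Polynomial.coeff_map]
    rcases hP i with h | h | h <;> simp [h]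
  have hm0 : P.map (Int.castRingHom ℂ) ≠ 0 :=
    (Polynomial.map_ne_zero_iff (RingHom.injective_int _)).2 h0
  have hroot : (P.map (Int.castRingHom ℂ)).IsRoot β := by
    rw [Polynomial.IsRoot, Polynomial.eval_map]
    exact hβ
  have h := hroot.norm_lt_cauchyBound hm0
  have hl : ‖(P.map (Int.castRingHom ℂ)).leadingCoeff‖₊ = 1 := by
    have : P.leadingCoeff ≠ 0 := by simpa using h0
    rw [Polynomial.leadingCoeff_map_of_injective (RingHom.injective_int _)]
    rcases hP P.natDegree with h | h | h <;> simp_all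
  have : Polynomial.cauchyBound (P.map (Int.castRingHom ℂ)) ≤ 2 := by
    unfold Polynomial.cauchyBound
    rw [hl, div_one, ← one_add_one_eq_two]
    gcongr
    exact Finset.sup_le (fun i _ => hn i)
  have h2 : ‖β‖₊ < 2 := lt_of_lt_of_le (by exact_mod_cast h) this
  exact_mod_cast h2

lemma small_root_gt (P : Polynomial ℤ) (hP : smallPoly P) (h0 : P ≠ 0) (β : ℂ) (hβ0 : β ≠ 0)
    (hβ : Polynomial.aeval β P = 0) : 1 / 2 < ‖β‖ := by
  have hr : smallPoly P.reverse := by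
    intro i
    rw [Polynomial.coeff_reverse]
    exact hP _
  have hr0 : P.reverse ≠ 0 := by simpa using h0
  have h := small_root_lt P.reverse hr hr0 β⁻¹ (by
    let _ := invertibleOfNonzero hβ0
    rw [← invOf_eq_inv, Polynomial.aeval_def, Polynomial.eval₂_reverse_eq_zero_iff]
    exact hβ)
  rw [norm_inv] at h
  have hb : 0 < ‖β‖ := norm_pos_iff.2 hβ0
  rw [inv_lt_comm₀ hb (by norm_num)] at h
  simpa using h

lemma algebra_key (P : Polynomial ℤ) (hP : smallPoly P) (h0 : P ≠ 0) (α : ℂ) (hα0 : α ≠ 0)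
    (h1 : Polynomial.aeval α P = 0) (h2 : Polynomial.aeval α (Polynomial.derivative P) = 0) :
    ∃ f : Polynomial ℤ, f.Monic ∧ Polynomial.aeval α f = 0 ∧ (f.eval 3) ^ 2 ∣ P.eval 3 ∧
      (5 / 4 : ℝ) ^ f.natDegree ≤ |((f.eval 3 : ℤ) : ℝ)| ∧
      (f.map (Int.castRingHom ℂ)).mahlerMeasure ≤ 2 ^ f.natDegree := by
  have hlead : P.leadingCoeff = 1 ∨ P.leadingCoeff = -1 := by
    have : P.leadingCoeff ≠ 0 := by simpa using h0
    rcases hP P.natDegree with h | h | h <;> simp_all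
  have hint : IsIntegral ℤ α := by
    rcases hlead with h | h
    · exact ⟨P, h, h1⟩
    · refine ⟨-P, ?_, ?_⟩
      · rw [Polynomial.Monic, Polynomial.leadingCoeff_neg, h]; norm_num
      · rw [Polynomial.eval₂_neg, ← Polynomial.aeval_def, h1, neg_zero]
  set f := minpoly ℤ α with hf
  have hfm : f.Monic := minpoly.monic hint
  have hfα : Polynomial.aeval α f = 0 := minpoly.aeval ℤ α
  obtain ⟨g, hg⟩ := minpoly.isIntegrallyClosed_dvd hint h1
  rw [← hf] at hg
  have hfd : Polynomial.aeval α (Polynomial.derivative f) ≠ 0 := by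
    intro h
    have hdvd := minpoly.isIntegrallyClosed_dvd hint h
    rw [← hf] at hdvd
    have hdeg : 0 < f.natDegree := minpoly.natDegree_pos hint
    have hlt := Polynomial.natDegree_derivative_lt hdeg.ne'
    have hne : Polynomial.derivative f ≠ 0 := by
      intro h
      have := Polynomial.derivative_eq_zero.1 h
      omega
    exact absurd (Polynomial.natDegree_le_of_dvd hdvd hne) (by omega)
  have hgα : Polynomial.aeval α g = 0 := by
    rw [hg, Polynomial.derivative_mul, map_add, map_mul, map_mul, hfα, zero_mul, add_zero] at h2
    exact (mul_eq_zero.1 h2).resolve_left hfd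
  obtain ⟨k, hk⟩ := minpoly.isIntegrallyClosed_dvd hint hgα
  rw [← hf] at hk
  have hsplit : (f.map (Int.castRingHom ℂ)).Splits := IsAlgClosed.splits _
  have hmm : (f.map (Int.castRingHom ℂ)).Monic := hfm.map _
  have hf00 : f.coeff 0 ≠ 0 := by
    intro h
    have hX : Polynomial.X ∣ f := Polynomial.X_dvd_iff.2 h
    obtain ⟨q, hq⟩ := hX
    have : Polynomial.aeval α q = 0 := by
      rw [hq, map_mul, Polynomial.aeval_X] at hfα
      exact (mul_eq_zero.1 hfα).resolve_left hα0
    have hdvd := minpoly.isIntegrallyClosed_dvd hint this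
    rw [← hf] at hdvd
    have hq0 : q ≠ 0 := by rintro rfl; simp at hq; exact hfm.ne_zero hq
    have := Polynomial.natDegree_le_of_dvd hdvd hq0
    rw [hq, Polynomial.natDegree_X_mul hq0] at this
    omega
  have hf0 : |f.coeff 0| = 1 := by
    have e : P.trailingCoeff = f.coeff 0 * g.trailingCoeff := by
      rw [hg, Polynomial.trailingCoeff_mul]
      congr 1
      rw [Polynomial.trailingCoeff, Polynomial.natTrailingDegree_eq_zero.2 (Or.inr hf00)]
    have ht : P.trailingCoeff = 1 ∨ P.trailingCoeff = -1 := by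
      have : P.trailingCoeff ≠ 0 := by simpa using h0
      rcases hP P.natTrailingDegree with h | h | h <;> simp_all [Polynomial.trailingCoeff]
    have hu : IsUnit (f.coeff 0) := by
      apply isUnit_of_dvd_unit (Dvd.intro _ e.symm)
      rcases ht with h | h <;> rw [h] <;> simp
    exact Int.isUnit_iff_abs_eq.1 hu
  have hroots : ∀ β ∈ (f.map (Int.castRingHom ℂ)).roots, 1 / 2 < ‖β‖ ∧ ‖β‖ < 2 := by
    intro β hβ
    have hβf : Polynomial.aeval β f = 0 := by
      have := Polynomial.isRoot_of_mem_roots hβ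
      rw [Polynomial.IsRoot, Polynomial.eval_map] at this
      exact this
    have hβP : Polynomial.aeval β P = 0 := by rw [hg, map_mul, hβf, zero_mul]
    refine ⟨small_root_gt P hP h0 β ?_ hβP, small_root_lt P hP h0 β hβP⟩
    rintro rfl
    apply hf00
    rw [← Polynomial.coeff_zero_eq_aeval_zero'] at hβf
    simpa using hβf
  have hcard : (f.map (Int.castRingHom ℂ)).roots.card = f.natDegree := by
    rw [← hsplit.natDegree_eq_card_roots, hfm.natDegree_map]
  refine ⟨f, hfm, hfα, ?_, ?_, ?_⟩
  · rw [hg, hk, Polynomial.eval_mul, Polynomial.eval_mul]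
    exact ⟨k.eval 3, by ring⟩
  · have e0 : ((f.map (Int.castRingHom ℂ)).roots.map (fun β => ‖β‖)).prod = 1 := by
      have h := hsplit.eval_eq_prod_roots_of_monic hmm 0
      have h' := congrArg norm h
      rw [← Polynomial.coeff_zero_eq_eval_zero, Polynomial.coeff_map, eq_intCast, Complex.norm_intCast,
        ← Int.cast_abs, hf0, cnorm_prod] at h'
      simpa using h'.symm
    have e3 : |((f.eval 3 : ℤ) : ℝ)| = ((f.map (Int.castRingHom ℂ)).roots.map (fun β => ‖3 - β‖)).prod := by
      have h := hsplit.eval_eq_prod_roots_of_monic hmm 3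
      have h' := congrArg norm h
      have h3 : (f.map (Int.castRingHom ℂ)).eval 3 = ((f.eval 3 : ℤ) : ℂ) := by
        have := Polynomial.eval_map_apply (Int.castRingHom ℂ) (p := f) 3
        simpa using this
      rw [h3, Complex.norm_intCast, cnorm_prod] at h'
      exact h'
    calc (5 / 4 : ℝ) ^ f.natDegree
        = ((f.map (Int.castRingHom ℂ)).roots.map (fun _ => (5/4 : ℝ))).prod := by
          rw [Multiset.map_const', Multiset.prod_replicate, hcard]
      _ ≤ ((f.map (Int.castRingHom ℂ)).roots.map (fun β => ‖β‖ * ‖3 - β‖)).prod := by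
          apply Multiset.prod_map_le_prod_map₀
          · intros; norm_num
          · intro β hβ
            obtain ⟨q1, q2⟩ := hroots β hβ
            have : 3 - ‖β‖ ≤ ‖3 - β‖ := by
              have := norm_sub_norm_le (3 : ℂ) β
              simpa using this
            nlinarith
      _ = _ := by rw [Multiset.prod_map_mul, e0, one_mul, e3]
  · rw [Polynomial.mahlerMeasure_eq_leadingCoeff_mul_prod_roots, hmm.leadingCoeff, norm_one, one_mul,
      ← hcard, ← Multiset.prod_replicate, ← Multiset.map_const']
    apply Multiset.prod_map_le_prod_map₀
    · intros; positivity
    · intro β hβ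
      exact max_le (by norm_num) (hroots β hβ).2.le

lemma digit_bound : ∀ (n k : ℕ) (e : Fin n → ℤ), (∀ j, |e j| ≤ 2) → (∀ j : Fin n, k ≤ (j : ℕ) → e j = 0) →
    |∑ j, e j * 3 ^ (j : ℕ)| < 3 ^ k := by
  intro n
  induction n with
  | zero => intro k e _ _; simp
  | succ n ih =>
    intro k e h2 hk
    cases k with
    | zero =>
      have : ∀ j, e j = 0 := fun j => hk j (Nat.zero_le _)
      simp [this]
    | succ k =>
      have := ih k (fun j => e j.succ) (fun j => h2 _) (fun j hj => hk _ (by simpa using hj))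
      have e1 : ∑ j, e j * 3 ^ (j : ℕ) = e 0 + 3 * ∑ j : Fin n, e j.succ * 3 ^ (j : ℕ) := by
        rw [Fin.sum_univ_succ, Finset.mul_sum]
        congr 1
        · simp
        · apply Finset.sum_congr rfl
          intro j _
          rw [Fin.val_succ]; ring
      rw [e1, pow_succ]
      have h0 := h2 0
      rw [abs_le] at h0
      rw [abs_lt] at this ⊢
      constructor <;> linarith

lemma digit_zero : ∀ (n : ℕ) (e : Fin n → ℤ), (∀ j, |e j| ≤ 2) →
    ∑ j, e j * 3 ^ (j : ℕ) = 0 → ∀ j, e j = 0 := by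
  intro n
  induction n with
  | zero => intro e _ _ j; exact j.elim0
  | succ n ih =>
    intro e h2 hs
    have e1 : ∑ j, e j * 3 ^ (j : ℕ) = e 0 + 3 * ∑ j : Fin n, e j.succ * 3 ^ (j : ℕ) := by
      rw [Fin.sum_univ_succ, Finset.mul_sum]
      congr 1
      · simp
      · apply Finset.sum_congr rfl
        intro j _
        rw [Fin.val_succ]; ring
    rw [e1] at hs
    have h0 := h2 0
    rw [abs_le] at h0
    have hz : e 0 = 0 := by omega
    have := ih (fun j => e j.succ) (fun j => h2 _) (by omega)
    intro j
    refine Fin.cases hz (fun i => this i) j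

lemma div_bound (μ : Measure ℤ) [IsProbabilityMeasure μ] (p : ENNReal) (hp : ∀ x, μ {x} ≤ p)
    (n d : ℕ) (hd0 : 1 ≤ d) :
    Measure.pi (fun _ : Fin (n + 1) => μ) {a | (∀ j, a j ∈ ({-1, 0, 1} : Set ℤ)) ∧ d ^ 2 < 3 ^ (n + 1) ∧
      ((d ^ 2 : ℕ) : ℤ) ∣ ∑ j, a j * 3 ^ (j : ℕ)} ≤ p ^ (Nat.log 3 (d ^ 2)) := by
  by_cases hd : d ^ 2 < 3 ^ (n + 1)
  swap
  · simp [hd]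
  set k := Nat.log 3 (d ^ 2) with hk
  have hpow : 3 ^ k ≤ d ^ 2 := Nat.pow_log_le_self 3 (by positivity)
  have hkn : k < n + 1 := by
    have := lt_of_le_of_lt hpow hd
    exact (Nat.pow_lt_pow_iff_right (by norm_num)).1 this
  have hcard : Fintype.card {j : Fin (n + 1) // (j : ℕ) < k} = k := by
    rw [Fintype.card_subtype]
    have := Fin.card_filter_val_lt (n := n + 1) (m := k)
    rw [this]; omega
  have := pi_inj_bound μ p hp (fun j : Fin (n + 1) => (j : ℕ) < k) {a | (∀ j, a j ∈ ({-1, 0, 1} : Set ℤ)) ∧ d ^ 2 < 3 ^ (n + 1) ∧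
      ((d ^ 2 : ℕ) : ℤ) ∣ ∑ j, a j * 3 ^ (j : ℕ)} ?_
  · rwa [hcard] at this
  · rintro a ⟨ha, -, hda⟩ b ⟨hb, -, hdb⟩ hab
    have h2 : ∀ j, |a j - b j| ≤ 2 := by
      intro j
      have h1 := ha j
      have h2 := hb j
      simp only [Set.mem_insert_iff, Set.mem_singleton_iff] at h1 h2
      rw [abs_le]; omega
    have hs : ∑ j, (a j - b j) * 3 ^ (j : ℕ) = ∑ j, a j * 3 ^ (j : ℕ) - ∑ j, b j * 3 ^ (j : ℕ) := by
      rw [← Finset.sum_sub_distrib]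
      exact Finset.sum_congr rfl (fun j _ => by ring)
    have hlt := digit_bound (n + 1) k (fun j => a j - b j) h2
      (fun j hj => by rw [hab j (by omega), sub_self])
    have hz : ∑ j, (a j - b j) * 3 ^ (j : ℕ) = 0 := by
      apply Int.eq_zero_of_abs_lt_dvd (m := ((d ^ 2 : ℕ) : ℤ))
      · rw [hs]; exact dvd_sub hda hdb
      · refine lt_of_lt_of_le hlt ?_
        exact_mod_cast hpow
    have := digit_zero (n + 1) (fun j => a j - b j) h2 hz
    funext j
    have := this j
    omega

lemma summ (p : ℝ) (hp0 : 0 < p) (hp : p < 1 / Real.sqrt 3) :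
    ∑' d : ℕ, (ENNReal.ofReal p) ^ (Nat.log 3 (d ^ 2)) ≠ ⊤ := by
  have hs3 : 0 < Real.sqrt 3 := by positivity
  have hs3' : 1 < Real.sqrt 3 := by
    rw [Real.lt_sqrt] <;> norm_num
  have hp1 : p < 1 := hp.trans (by rw [div_lt_one hs3]; exact hs3')
  have hl3 : 0 < Real.log 3 := Real.log_pos (by norm_num)
  set s := Real.log p / Real.log 3 with hs
  have hsl : s < -1 / 2 := by
    rw [hs, div_lt_iff₀ hl3]
    have := Real.log_lt_log hp0 hp
    rw [one_div, Real.log_inv, Real.log_sqrt (by norm_num)] at this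
    linarith
  have hp3 : (3 : ℝ) ^ s = p := by
    rw [Real.rpow_def_of_pos (by norm_num), hs, mul_div_cancel₀ _ hl3.ne', Real.exp_log hp0]
  have hsum : Summable (fun d : ℕ => p ^ (Nat.log 3 (d ^ 2))) := by
    have hmaj : Summable (fun d : ℕ => p⁻¹ * (d : ℝ) ^ (2 * s)) :=
      (Real.summable_nat_rpow.2 (by linarith)).mul_left _
    rw [← summable_nat_add_iff 1] at hmaj ⊢
    refine Summable.of_nonneg_of_le (fun d => by positivity) (fun d => ?_) hmaj
    set m := d + 1 with hm
    have hmpos : (0 : ℝ) < (m : ℝ) := by positivity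
    set k := Nat.log 3 (m ^ 2) with hk
    have hlt : m ^ 2 < 3 ^ (k + 1) := Nat.lt_pow_succ_log_self (by norm_num) _
    have hlt' : (m : ℝ) ^ (2 : ℝ) ≤ (3 : ℝ) ^ ((k + 1 : ℕ) : ℝ) := by
      rw [Real.rpow_natCast, Real.rpow_two]
      exact_mod_cast hlt.le
    have h1 : p ^ (k + 1) ≤ (m : ℝ) ^ (2 * s) := by
      rw [← hp3, ← Real.rpow_natCast, ← Real.rpow_mul (by norm_num), mul_comm s, Real.rpow_mul (by norm_num),
        Real.rpow_mul hmpos.le]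
      exact Real.rpow_le_rpow_of_nonpos (by positivity) hlt' (by linarith)
    rw [pow_succ] at h1
    rw [inv_mul_eq_div, le_div_iff₀ hp0]
    exact h1
  have := hsum.tsum_ofReal_ne_top
  simpa [ENNReal.ofReal_pow hp0.le] using this

lemma exists_Z (D : ℕ) : ∃ Z : Finset ℂ, (0 : ℂ) ∉ Z ∧ ∀ (P : Polynomial ℤ) (α : ℂ), smallPoly P → P ≠ 0 →
    α ≠ 0 → Polynomial.aeval α P = 0 → Polynomial.aeval α (Polynomial.derivative P) = 0 →
    (∃ d : ℕ, D ≤ d ∧ ((d ^ 2 : ℕ) : ℤ) ∣ P.eval 3) ∨ α ∈ Z := by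
  obtain ⟨N, hN⟩ := pow_unbounded_of_one_lt (D : ℝ) (show (1 : ℝ) < 5 / 4 by norm_num)
  have hfin := Polynomial.finite_mahlerMeasure_le N (2 ^ N)
  have hfin2 : (⋃ f ∈ {p : Polynomial ℤ | p.natDegree ≤ N ∧
      (p.map (Int.castRingHom ℂ)).mahlerMeasure ≤ ((2 ^ N : NNReal) : ℝ)},
      {z : ℂ | z ∈ (f.map (Int.castRingHom ℂ)).roots}).Finite :=
    hfin.biUnion (fun f _ => Multiset.finite_toSet _)
  refine ⟨hfin2.toFinset.erase 0, by simp, ?_⟩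
  intro P α hP h0 hα h1 h2
  obtain ⟨f, hm, hfα, hdvd, hdeg, hmah⟩ := algebra_key P hP h0 α hα h1 h2
  by_cases hD : D ≤ (f.eval 3).natAbs
  · left
    refine ⟨_, hD, ?_⟩
    rwa [Nat.cast_pow, Int.natCast_natAbs, sq_abs]
  · right
    have hdN : f.natDegree ≤ N := by
      by_contra hcon
      push Not at hcon hD
      have h3 : |((f.eval 3 : ℤ) : ℝ)| < D := by
        rw [← Int.cast_abs, Int.abs_eq_natAbs]
        exact_mod_cast hD
      have h4 : (5 / 4 : ℝ) ^ N ≤ (5 / 4) ^ f.natDegree := pow_le_pow_right₀ (by norm_num) hcon.le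
      linarith
    rw [Finset.mem_erase]
    refine ⟨hα, ?_⟩
    rw [Set.Finite.mem_toFinset]
    refine Set.mem_biUnion (x := f) ⟨hdN, hmah.trans ?_⟩ ?_
    · push_cast
      exact pow_le_pow_right₀ (by norm_num) hdN
    · rw [Set.mem_ofPred_eq, Polynomial.mem_roots (hm.map _).ne_zero, Polynomial.IsRoot, Polynomial.eval_map]
      exact hfα

lemma exists_g (μ : Measure ℤ) [IsProbabilityMeasure μ]
    (hsupp : μ (({-1, 0, 1} : Set ℤ)ᶜ) = 0)
    (hC : ∀ x ∈ ({-1, 0, 1} : Set ℤ), μ {x} < 1) :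
    ∃ (c : ENNReal) (g : ℤ → ℤ), c ≠ 0 ∧
      ∀ x ∈ ({-1, 0, 1} : Set ℤ), g x ≠ x ∧ g x ∈ ({-1, 0, 1} : Set ℤ) ∧ c ≤ μ {g x} := by
  have h : ∀ x : ℤ, ∃ y : ℤ, x ∈ ({-1, 0, 1} : Set ℤ) → y ≠ x ∧ y ∈ ({-1, 0, 1} : Set ℤ) ∧ μ {y} ≠ 0 := by
    intro x
    by_cases hx : x ∈ ({-1, 0, 1} : Set ℤ)
    swap
    · exact ⟨0, fun h => absurd h hx⟩
    by_contra hcon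
    push Not at hcon
    have hy : ∀ y ∈ ({x}ᶜ : Set ℤ), μ {y} = 0 := by
      intro y hy
      by_cases hyS : y ∈ ({-1, 0, 1} : Set ℤ)
      · exact (hcon y).2 hy hyS
      · exact measure_mono_null (by simpa using hyS) hsupp
    have hz : μ ({x}ᶜ : Set ℤ) = 0 := by
      rw [← Set.biUnion_of_singleton ({x}ᶜ : Set ℤ), measure_biUnion_null_iff (Set.to_countable _)]
      exact hy
    have := hC x hx
    rw [prob_compl_eq_zero_iff (MeasurableSet.singleton x)] at hz
    exact absurd hz this.ne
  choose g hg using h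
  refine ⟨min (μ {g (-1)}) (min (μ {g 0}) (μ {g 1})), g, ?_, ?_⟩
  · have h1 := (hg (-1) (by simp)).2.2
    have h2 := (hg 0 (by simp)).2.2
    have h3 := (hg 1 (by simp)).2.2
    rw [← pos_iff_ne_zero] at *
    exact lt_min h1 (lt_min h2 h3)
  · intro x hx
    refine ⟨(hg x hx).1, (hg x hx).2.1, ?_⟩
    simp only [Set.mem_insert_iff, Set.mem_singleton_iff] at hx
    rcases hx with rfl | rfl | rfl <;> simp

noncomputable def Pz (n : ℕ) (a : Fin (n + 1) → ℤ) : Polynomial ℤ :=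
  ∑ j : Fin (n + 1), Polynomial.C (a j) * Polynomial.X ^ (j : ℕ)

lemma Pz_map (n : ℕ) (a : Fin (n + 1) → ℤ) : (Pz n a).map (Int.castRingHom ℂ) = polyOf n a := by
  simp [Pz, polyOf, Polynomial.map_sum]

lemma Pz_eval (n : ℕ) (a : Fin (n + 1) → ℤ) : (Pz n a).eval 3 = ∑ j, a j * 3 ^ (j : ℕ) := by
  simp [Pz, Polynomial.eval_finsetSum]

lemma Pz_coeff (n : ℕ) (a : Fin (n + 1) → ℤ) (j : Fin (n + 1)) : (Pz n a).coeff j = a j := by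
  simp [Pz, Polynomial.finsetSum_coeff, Polynomial.coeff_X_pow, Fin.val_inj]

lemma Pz_small (n : ℕ) (a : Fin (n + 1) → ℤ) (ha : ∀ j, a j ∈ ({-1, 0, 1} : Set ℤ)) : smallPoly (Pz n a) := by
  intro i
  by_cases hi : i < n + 1
  · have := Pz_coeff n a ⟨i, hi⟩
    simp only at this
    rw [this]
    simpa using ha ⟨i, hi⟩
  · right; left
    simp only [Pz, Polynomial.finsetSum_coeff, Polynomial.coeff_C_mul, Polynomial.coeff_X_pow]
    apply Finset.sum_eq_zero
    intro j _
    rw [if_neg (by omega), mul_zero]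

lemma root_bound (μ : Measure ℤ) [IsProbabilityMeasure μ]
    (c : ENNReal) (g : ℤ → ℤ)
    (hg : ∀ x ∈ ({-1, 0, 1} : Set ℤ), g x ≠ x ∧ g x ∈ ({-1, 0, 1} : Set ℤ) ∧ c ≤ μ {g x})
    (n : ℕ) (α : ℂ) (hα : α ≠ 0) :
    (n : ENNReal) * c * Measure.pi (fun _ : Fin (n + 1) => μ)
      {a | (∀ j, a j ∈ ({-1, 0, 1} : Set ℤ)) ∧ (polyOf n a).eval α = 0 ∧
        (Polynomial.derivative (polyOf n a)).eval α = 0} ≤ 2 := by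
  have hJ : ((Finset.univ : Finset (Fin (n + 1))).erase 0).card = n := by simp
  have hα' : 0 < ‖α‖ := norm_pos_iff.2 hα
  by_cases h1 : ‖α‖ = 1
  · have := anticonc μ c g hg ((Finset.univ : Finset (Fin (n + 1))).erase 0)
      (fun j => ((j : ℕ) : ℂ) * α ^ ((j : ℕ) - 1)) ?_ ?_
    · rw [hJ] at this
      refine le_trans ?_ this
      gcongr
      rename_i a
      rintro ⟨-, h⟩
      simpa [polyOf, Polynomial.eval_finsetSum, Polynomial.derivative_X_pow, mul_assoc] using h
    · intro j hj
      have : (j : ℕ) ≠ 0 := fun h => Finset.ne_of_mem_erase hj (Fin.ext h)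
      exact mul_ne_zero (by exact_mod_cast this) (pow_ne_zero _ hα)
    · intro i _ j _ h
      simp only [norm_mul, norm_pow, h1, one_pow, mul_one, Complex.norm_natCast] at h
      exact Fin.ext (by exact_mod_cast h)
  · have := anticonc μ c g hg ((Finset.univ : Finset (Fin (n + 1))).erase 0)
      (fun j => α ^ (j : ℕ)) ?_ ?_
    · rw [hJ] at this
      refine le_trans ?_ this
      gcongr
      rename_i a
      rintro ⟨h, -⟩
      simpa [polyOf, Polynomial.eval_finsetSum] using h
    · intro j hj
      exact pow_ne_zero _ hα
    · intro i _ j _ h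
      simp only [norm_pow] at h
      exact Fin.ext (pow_right_injective₀ hα' h1 h)

lemma zero_event (μ : Measure ℤ) [IsProbabilityMeasure μ] (n : ℕ) :
    Measure.pi (fun _ : Fin (n + 1 + 1) => μ) {a | a 0 = 0 ∧ a 1 = 0} = μ {0} ^ 2 := by
  have : {a : Fin (n + 1 + 1) → ℤ | a 0 = 0 ∧ a 1 = 0} =
      Set.pi Set.univ (fun j : Fin (n + 1 + 1) => if j = 0 ∨ j = 1 then ({0} : Set ℤ) else Set.univ) := by
    ext a
    simp only [Set.mem_ofPred_eq, Set.mem_pi, Set.mem_univ, true_imp_iff]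
    constructor
    · rintro ⟨h0, h1⟩ j
      split_ifs with h
      · rcases h with rfl | rfl <;> simpa
      · trivial
    · intro h
      exact ⟨by simpa using h 0, by simpa using h 1⟩
  rw [this, Measure.pi_pi, Fin.prod_univ_succ, Fin.prod_univ_succ]
  have h2 : ∀ i : Fin n, ¬ (i.succ.succ = 0 ∨ i.succ.succ = (1 : Fin (n + 1 + 1))) := by
    intro i
    simp [Fin.ext_iff]
  have h3 : ∀ i : Fin n, ¬ (i.succ.succ = (1 : Fin (n + 1 + 1))) := fun i h => h2 i (Or.inr h)
  simp [h3, sq]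

/-- Under condition (C), the probability that `P_n` has a double root converges to `μ({0})²`. -/
theorem double_root_prob_limit (μ : MeasureTheory.Measure ℤ) [IsProbabilityMeasure μ]
    (hsupp : μ (({-1, 0, 1} : Set ℤ)ᶜ) = 0)
    (hC : ∀ x ∈ ({-1, 0, 1} : Set ℤ), (μ {x}).toReal < 1 / Real.sqrt 3) :
    Tendsto (fun n : ℕ =>
        ((Measure.pi fun _ : Fin (n + 1) => μ) {a | hasDoubleRoot n a}).toReal)
      atTop (nhds ((μ {0}).toReal ^ 2)) := by
  have hs3 : 0 < Real.sqrt 3 := by positivity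
  have hs3' : 1 < Real.sqrt 3 := by
    rw [Real.lt_sqrt] <;> norm_num
  have hlt1 : 1 / Real.sqrt 3 < 1 := by rw [div_lt_one hs3]; exact hs3'
  have hhalf : 1 / 2 < 1 / Real.sqrt 3 := by
    apply one_div_lt_one_div_of_lt hs3
    rw [Real.sqrt_lt'] <;> norm_num
  obtain ⟨c, g, hc0, hg⟩ := exists_g μ hsupp (fun x hx => by
    have := (hC x hx).trans hlt1
    rwa [← ENNReal.toReal_one, ENNReal.toReal_lt_toReal (measure_ne_top _ _) ENNReal.one_ne_top] at this)
  have hctop : c ≠ ⊤ :=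
    ne_top_of_le_ne_top (measure_ne_top μ _) (hg 0 (by simp)).2.2
  obtain ⟨p, hp0, hp3, hp⟩ : ∃ p : ℝ, 0 < p ∧ p < 1 / Real.sqrt 3 ∧ ∀ x, μ {x} ≤ ENNReal.ofReal p := by
    refine ⟨max (1 / 2) (max (μ {-1}).toReal (max (μ {0}).toReal (μ {1}).toReal)), by positivity, ?_, ?_⟩
    · exact max_lt hhalf (max_lt (hC _ (by simp)) (max_lt (hC _ (by simp)) (hC _ (by simp))))
    · intro x
      by_cases hx : x ∈ ({-1, 0, 1} : Set ℤ)
      · rw [ENNReal.le_ofReal_iff_toReal_le (measure_ne_top _ _) (by positivity)]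
        simp only [Set.mem_insert_iff, Set.mem_singleton_iff] at hx
        rcases hx with rfl | rfl | rfl <;> simp
      · rw [measure_mono_null (by simpa using hx) hsupp]
        exact zero_le
  have hR : Tendsto (fun n : ℕ => (Measure.pi fun _ : Fin (n + 1 + 1) => μ)
      ({a | hasDoubleRoot (n + 1) a} \ {a | a 0 = 0 ∧ a 1 = 0})) atTop (nhds 0) := by
    rw [ENNReal.tendsto_nhds_zero]
    intro ε hε
    have htail := ENNReal.tendsto_sum_nat_add _ (summ p hp0 hp3)
    rw [ENNReal.tendsto_nhds_zero] at htail
    have hε2 : 0 < ε / 2 := ENNReal.half_pos hε.ne'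
    obtain ⟨D, hDt, hD1⟩ := ((htail _ hε2).and (eventually_ge_atTop 1)).exists
    obtain ⟨Z, hZ0, hZ⟩ := exists_Z D
    have hlim : Tendsto (fun n : ℕ => (Z.card : ENNReal) * (2 / (((n + 1 : ℕ) : ENNReal) * c))) atTop (nhds 0) := by
      have h1 : Tendsto (fun n : ℕ => (((n + 1 : ℕ) : ENNReal))⁻¹) atTop (nhds 0) :=
        ENNReal.tendsto_inv_nat_nhds_zero.comp (tendsto_add_atTop_nat 1)
      have h2 := ENNReal.Tendsto.const_mul (a := (Z.card : ENNReal) * (2 * c⁻¹)) h1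
        (Or.inr (ENNReal.mul_ne_top (ENNReal.natCast_ne_top _)
          (ENNReal.mul_ne_top (by norm_num) (ENNReal.inv_ne_top.2 hc0))))
      rw [mul_zero] at h2
      refine h2.congr (fun n => ?_)
      rw [div_eq_mul_inv, ENNReal.mul_inv (Or.inr hctop) (Or.inr hc0)]
      ring
    rw [ENNReal.tendsto_nhds_zero] at hlim
    filter_upwards [hlim _ hε2] with n hn
    set ν := (Measure.pi fun _ : Fin (n + 1 + 1) => μ) with hν
    have hae : ν {a | ∀ j, a j ∈ ({-1, 0, 1} : Set ℤ)}ᶜ = 0 := by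
      have : ∀ᵐ a ∂ν, ∀ j, a j ∈ ({-1, 0, 1} : Set ℤ) := by
        rw [ae_all_iff]
        intro j
        have h1 : ∀ᵐ x ∂μ, x ∈ ({-1, 0, 1} : Set ℤ) := hsupp
        exact (Measure.tendsto_eval_ae_ae (μ := fun _ : Fin (n + 1 + 1) => μ) (i := j)).eventually h1
      exact this
    let E : ℕ → Set (Fin (n + 1 + 1) → ℤ) := fun d =>
      {a | (∀ j, a j ∈ ({-1, 0, 1} : Set ℤ)) ∧ d ^ 2 < 3 ^ (n + 1 + 1) ∧
        ((d ^ 2 : ℕ) : ℤ) ∣ ∑ j, a j * 3 ^ (j : ℕ)}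
    let A : ℂ → Set (Fin (n + 1 + 1) → ℤ) := fun α =>
      {a | (∀ j, a j ∈ ({-1, 0, 1} : Set ℤ)) ∧ (polyOf (n + 1) a).eval α = 0 ∧
        (Polynomial.derivative (polyOf (n + 1) a)).eval α = 0}
    have hsub : ({a | hasDoubleRoot (n + 1) a} \ {a | a 0 = 0 ∧ a 1 = 0}) ⊆
        {a | ∀ j, a j ∈ ({-1, 0, 1} : Set ℤ)}ᶜ ∪ ((⋃ d, E (d + D)) ∪ ⋃ α ∈ Z, A α) := by
      rintro a ⟨⟨α, hα1, hα2⟩, hna⟩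
      by_cases ha : ∀ j, a j ∈ ({-1, 0, 1} : Set ℤ)
      swap
      · left; exact ha
      right
      have hsm := Pz_small (n + 1) a ha
      have hP0 : Pz (n + 1) a ≠ 0 := by
        intro h
        apply hna
        have h0 := Pz_coeff (n + 1) a 0
        have h1 := Pz_coeff (n + 1) a 1
        rw [h, Polynomial.coeff_zero] at h0 h1
        exact ⟨h0.symm, h1.symm⟩
      have hz : α ≠ 0 := by
        rintro rfl
        apply hna
        have h0 := Pz_coeff (n + 1) a 0
        have h1 := Pz_coeff (n + 1) a 1
        rw [← Pz_map] at hα1 hα2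
        rw [← Polynomial.coeff_zero_eq_eval_zero, Polynomial.coeff_map] at hα1
        rw [← Polynomial.coeff_zero_eq_eval_zero, Polynomial.coeff_derivative, Polynomial.coeff_map] at hα2
        refine ⟨?_, ?_⟩
        · rw [← h0]; simpa using hα1
        · rw [← h1]; simpa using hα2
      have e1 : Polynomial.aeval α (Pz (n + 1) a) = 0 := by
        rw [← Pz_map, Polynomial.eval_map] at hα1
        exact hα1
      have e2 : Polynomial.aeval α (Polynomial.derivative (Pz (n + 1) a)) = 0 := by
        rw [← Pz_map, Polynomial.derivative_map, Polynomial.eval_map] at hα2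
        exact hα2
      rcases hZ _ α hsm hP0 hz e1 e2 with ⟨d, hd, hdvd⟩ | h
      · left
        refine Set.mem_iUnion.2 ⟨d - D, ?_⟩
        rw [Nat.sub_add_cancel hd]
        rw [Pz_eval] at hdvd
        refine ⟨ha, ?_, hdvd⟩
        have h2 : ∀ j, |a j| ≤ 2 := by
          intro j
          have h1 := ha j
          simp only [Set.mem_insert_iff, Set.mem_singleton_iff] at h1
          rw [abs_le]; omega
        have hb := digit_bound (n + 1 + 1) (n + 1 + 1) a h2 (fun j hj => by have := j.2; omega)
        have hne : ∑ j, a j * 3 ^ (j : ℕ) ≠ 0 := by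
          intro h
          have := digit_zero _ a h2 h
          exact hna ⟨this 0, this 1⟩
        have h3 : ((d ^ 2 : ℕ) : ℤ) ≤ |∑ j, a j * 3 ^ (j : ℕ)| :=
          Int.le_of_dvd (abs_pos.2 hne) ((dvd_abs _ _).2 hdvd)
        exact_mod_cast lt_of_le_of_lt h3 hb
      · right
        exact Set.mem_biUnion h ⟨ha, hα1, hα2⟩
    have hE : ν (⋃ d, E (d + D)) ≤ ε / 2 := by
      refine (measure_iUnion_le _).trans (le_trans (ENNReal.tsum_le_tsum fun d => ?_) hDt)
      exact div_bound μ _ hp (n + 1) (d + D) (by omega)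
    have hA : ν (⋃ α ∈ Z, A α) ≤ ε / 2 := by
      refine (measure_biUnion_finset_le _ _).trans (le_trans ?_ hn)
      rw [← nsmul_eq_mul]
      apply Finset.sum_le_card_nsmul
      intro α hα
      have hb := root_bound μ c g hg (n + 1) α (fun h => hZ0 (h ▸ hα))
      rw [ENNReal.le_div_iff_mul_le, mul_comm]
      · exact hb
      · left; exact mul_ne_zero (by simp) hc0
      · left; exact ENNReal.mul_ne_top (ENNReal.natCast_ne_top _) hctop
    calc _ ≤ ν ({a | ∀ j, a j ∈ ({-1, 0, 1} : Set ℤ)}ᶜ ∪ ((⋃ d, E (d + D)) ∪ ⋃ α ∈ Z, A α)) := measure_mono hsub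
      _ ≤ 0 + (ε / 2 + ε / 2) := by
        refine (measure_union_le _ _).trans (add_le_add hae.le ?_)
        exact (measure_union_le _ _).trans (add_le_add hE hA)
      _ = ε := by rw [zero_add, ENNReal.add_halves]
  rw [← tendsto_add_atTop_iff_nat 1]
  rw [← ENNReal.toReal_pow]
  refine (ENNReal.tendsto_toReal (by finiteness)).comp ?_
  have h := hR.const_add (μ {0} ^ 2)
  rw [add_zero] at h
  refine h.congr (fun n => ?_)
  have hsub : {a : Fin (n + 1 + 1) → ℤ | a 0 = 0 ∧ a 1 = 0} ⊆ {a | hasDoubleRoot (n + 1) a} := by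
    rintro a ⟨ha0, ha1⟩
    have h0 := Pz_coeff (n + 1) a 0
    have h1 := Pz_coeff (n + 1) a 1
    refine ⟨0, ?_, ?_⟩
    · rw [← Pz_map, ← Polynomial.coeff_zero_eq_eval_zero, Polynomial.coeff_map]
      rw [ha0] at h0
      simpa using h0
    · rw [← Pz_map, ← Polynomial.coeff_zero_eq_eval_zero, Polynomial.coeff_derivative, Polynomial.coeff_map]
      rw [ha1] at h1
      simpa using h1
  have hm := measure_inter_add_diff (μ := Measure.pi fun _ : Fin (n + 1 + 1) => μ)
    {a | hasDoubleRoot (n + 1) a}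
    (Set.to_countable {a : Fin (n + 1 + 1) → ℤ | a 0 = 0 ∧ a 1 = 0}).measurableSet
  rw [Set.inter_eq_self_of_subset_right hsub, zero_event] at hm
  exact hm
end
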